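/- arXiv:1701.02974 — 4 statements merged into one kernel-verified Lean document; each statement's English description precedes it below -/
import Mathlib

section
/- For every non negative integer n, the equation 3(4x+1)² + 3(4y+1)² + (12z+1)² = 24n + 7 has an integer solution x, y, z. -/
open Matrix

/-- Every integer can be translated by a multiple of `p > 0` into `[-p/2, p/2]`. -/
lemma exists_two_mul_abs_add_mul_le (r p : ℤ) (hp : 0 < p) : ∃ t : ℤ, 2 * |r + t * p| ≤ p := by
  have h1 := Int.emod_add_mul_ediv r p
  have h2 := Int.emod_nonneg r hp.ne'
  have h3 := Int.emod_lt_of_pos r hp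
  rcases le_or_gt (2 * (r % p)) p with h | h
  · refine ⟨-(r / p), ?_⟩
    have : r + -(r / p) * p = r % p := by linarith
    rw [this, abs_of_nonneg h2]
    exact h
  · refine ⟨-(r / p) - 1, ?_⟩
    have : r + (-(r / p) - 1) * p = r % p - p := by linarith
    rw [this, abs_of_neg (by linarith)]
    linarith

lemma four_mul_sq_le_of_two_mul_abs_le {r p : ℤ} (h : 2 * |r| ≤ p) : 4 * r ^ 2 ≤ p ^ 2 := by
  have h0 := abs_nonneg r
  have h1 : (2 * |r|) ^ 2 ≤ p ^ 2 := by gcongr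
  have h2 := sq_abs r
  nlinarith

/-- Hermite's bound for the minimum of a positive definite binary quadratic form. -/
lemma exists_reduced_binary_form (n : ℕ) : ∀ p r s : ℤ, p.toNat ≤ n → 0 < p → 0 < p * s - r ^ 2 →
    ∃ α β γ δ : ℤ, α * δ - β * γ = 1 ∧
      3 * (p * α ^ 2 + 2 * r * α * γ + s * γ ^ 2) ^ 2 ≤ 4 * (p * s - r ^ 2) := by
  induction n with
  | zero => intro p r s hn hp; omega
  | succ n ih =>
    intro p r s hn hp hd
    obtain ⟨t, ht⟩ := exists_two_mul_abs_add_mul_le r p hp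
    have hsq := four_mul_sq_le_of_two_mul_abs_le ht
    set r' := r + t * p with hr'
    set s' := s + 2 * t * r + t ^ 2 * p with hs'
    have hdet : p * s' - r' ^ 2 = p * s - r ^ 2 := by rw [hr', hs']; ring
    rcases le_or_gt p s' with h | h
    · refine ⟨1, 0, 0, 1, by ring, ?_⟩
      nlinarith
    · have hs0 : 0 < s' := by
        by_contra hneg
        nlinarith [sq_nonneg r']
      obtain ⟨α, β, γ, δ, hu, hb⟩ := ih s' (-r') p (by omega) hs0 (by nlinarith)
      refine ⟨t * α - γ, t * β - δ, α, β, by linear_combination hu, ?_⟩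
      have e1 : p * (t * α - γ) ^ 2 + 2 * r * (t * α - γ) * α + s * α ^ 2
          = s' * α ^ 2 + 2 * -r' * α * γ + p * γ ^ 2 := by rw [hr', hs']; ring
      rw [e1]
      linarith

/-- A positive definite binary form of determinant `3` is equivalent to
`x² + 3y²` or to `2x² + 2xy + 2y²`. -/
lemma binary_form_det_three (n : ℕ) : ∀ p r s : ℤ, p.toNat ≤ n → 0 < p → p * s - r ^ 2 = 3 →
    ∃ x₁ y₁ x₂ y₂ : ℤ,
      (p = x₁ ^ 2 + 3 * y₁ ^ 2 ∧ r = x₁ * x₂ + 3 * y₁ * y₂ ∧ s = x₂ ^ 2 + 3 * y₂ ^ 2) ∨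
      (p = 2 * (x₁ ^ 2 + x₁ * y₁ + y₁ ^ 2) ∧ r = 2 * x₁ * x₂ + x₁ * y₂ + x₂ * y₁ + 2 * y₁ * y₂ ∧
        s = 2 * (x₂ ^ 2 + x₂ * y₂ + y₂ ^ 2)) := by
  induction n with
  | zero => intro p r s hn hp; omega
  | succ n ih =>
    intro p r s hn hp hd
    rcases (by omega : p = 1 ∨ p = 2 ∨ 3 ≤ p) with rfl | rfl | h3
    · exact ⟨1, 0, r, 1, Or.inl ⟨by ring, by ring, by linarith⟩⟩
    · obtain ⟨k, rfl | rfl⟩ := Int.even_or_odd' r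
      · exfalso
        have : 2 * (s - 2 * k ^ 2) = 3 := by linarith
        omega
      · exact ⟨1, 0, k, 1, Or.inr ⟨by ring, by ring, by linarith⟩⟩
    · obtain ⟨t, ht⟩ := exists_two_mul_abs_add_mul_le r p hp
      have hsq := four_mul_sq_le_of_two_mul_abs_le ht
      set r' := r + t * p with hr'
      set s' := s + 2 * t * r + t ^ 2 * p with hs'
      have hdet : p * s' - r' ^ 2 = 3 := by rw [← hd, hr', hs']; ring
      have hs0 : 0 < s' := by
        by_contra hneg
        nlinarith [sq_nonneg r']
      have hlt : s' < p := by
        by_contra hge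
        nlinarith
      obtain ⟨x₁, y₁, x₂, y₂, h⟩ := ih s' r' p (by omega) hs0 (by linarith)
      refine ⟨x₂, y₂, x₁ - t * x₂, y₁ - t * y₂, ?_⟩
      rcases h with ⟨h₁, h₂, h₃⟩ | ⟨h₁, h₂, h₃⟩
      · left
        refine ⟨h₃, ?_, ?_⟩
        · linear_combination h₂ - hr' - t * h₃
        · linear_combination h₁ - hs' - 2 * t * h₂ + 2 * t * hr' + t ^ 2 * h₃
      · right
        refine ⟨h₃, ?_, ?_⟩
        · linear_combination h₂ - hr' - t * h₃
        · linear_combination h₁ - hs' - 2 * t * h₂ + 2 * t * hr' + t ^ 2 * h₃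

lemma gram_change_basis (a b c d e f t α β γ δ : ℤ) :
    !![a * t ^ 2 + b * α ^ 2 + c * γ ^ 2 + 2 * d * t * α + 2 * e * t * γ + 2 * f * α * γ,
        -(d * α + e * γ + t * a),
        t * (d * β + e * δ) + b * α * β + f * (α * δ + β * γ) + c * γ * δ;
      -(d * α + e * γ + t * a), a, -(d * β + e * δ);
      t * (d * β + e * δ) + b * α * β + f * (α * δ + β * γ) + c * γ * δ,
        -(d * β + e * δ), b * β ^ 2 + 2 * f * β * δ + c * δ ^ 2] =
      !![t, -1, 0; α, 0, β; γ, 0, δ]ᵀ * !![a, d, e; d, b, f; e, f, c] *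
        !![t, -1, 0; α, 0, β; γ, 0, δ] := by
  ext i j
  fin_cases i <;> fin_cases j <;> simp [Matrix.mul_apply, Fin.sum_univ_three] <;> ring

lemma change_basis_mul_inverse (t α β γ δ : ℤ) (hu : α * δ - β * γ = 1) :
    !![t, -1, 0; α, 0, β; γ, 0, δ] * !![0, δ, -β; -1, t * δ, -t * β; 0, -γ, α] = 1 := by
  ext i j
  fin_cases i <;> fin_cases j <;> simp [Matrix.mul_apply, Fin.sum_univ_three] <;>
    first | ring1 | linear_combination hu

lemma eq_gram_mul_of_mul_eq_one {A D M U V : Matrix (Fin 3) (Fin 3) ℤ} (hUV : U * V = 1)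
    (h : Uᵀ * A * U = Mᵀ * D * M) : A = (M * V)ᵀ * D * (M * V) := by
  have hVU : Vᵀ * Uᵀ = 1 := by rw [← transpose_mul, hUV, transpose_one]
  calc A = (Vᵀ * Uᵀ) * A * (U * V) := by rw [hVU, hUV]; simp
    _ = Vᵀ * (Uᵀ * A * U) * V := by simp only [Matrix.mul_assoc]
    _ = _ := by rw [h, transpose_mul]; simp only [Matrix.mul_assoc]

/-- One step of the reduction of positive definite ternary forms of determinant `3`. -/
lemma exists_smaller_value_ternary_form (a b c d e f : ℤ) (h2 : 2 ≤ a) (hm : 0 < a * b - d ^ 2)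
    (hdet : a * b * c + 2 * d * e * f - a * f ^ 2 - b * e ^ 2 - c * d ^ 2 = 3) :
    ∃ t α β γ δ a' l : ℤ, α * δ - β * γ = 1 ∧ l = d * α + e * γ + t * a ∧
      a' = a * t ^ 2 + b * α ^ 2 + c * γ ^ 2 + 2 * d * t * α + 2 * e * t * γ + 2 * f * α * γ ∧
      0 < a' ∧ a' < a ∧ 0 < a * a' - l ^ 2 := by
  have ha : 0 < a := by linarith
  obtain ⟨α, β, γ, δ, hu, hb⟩ := exists_reduced_binary_form (a * b - d ^ 2).toNat
    (a * b - d ^ 2) (a * f - d * e) (a * c - e ^ 2) le_rfl hm (by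
      have : (a * b - d ^ 2) * (a * c - e ^ 2) - (a * f - d * e) ^ 2 = a * 3 := by
        rw [← hdet]; ring
      rw [this]; linarith)
  have hG : (a * b - d ^ 2) * (a * c - e ^ 2) - (a * f - d * e) ^ 2 = 3 * a := by
    linear_combination a * hdet
  rw [hG] at hb
  set g := (a * b - d ^ 2) * α ^ 2 + 2 * (a * f - d * e) * α * γ + (a * c - e ^ 2) * γ ^ 2
    with hg
  obtain ⟨t, ht⟩ := exists_two_mul_abs_add_mul_le (d * α + e * γ) a ha
  have hsq := four_mul_sq_le_of_two_mul_abs_le ht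
  set l := d * α + e * γ + t * a with hl
  set a' := a * t ^ 2 + b * α ^ 2 + c * γ ^ 2 + 2 * d * t * α + 2 * e * t * γ + 2 * f * α * γ
    with ha'
  have hag : a * a' = l ^ 2 + g := by rw [hl, hg, ha']; ring
  have hgpos : 0 < g := by
    have h4 : (a * b - d ^ 2) * g
        = ((a * b - d ^ 2) * α + (a * f - d * e) * γ) ^ 2 + 3 * a * γ ^ 2 := by
      rw [hg, ← hG]; ring
    have h5 : 0 < (a * b - d ^ 2) * g := by
      rw [h4]
      rcases eq_or_ne γ 0 with h0 | h0
      · have hα : α ≠ 0 := by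
          rintro rfl
          rw [h0] at hu
          simp at hu
        rw [h0]
        have : (a * b - d ^ 2) * α ≠ 0 := mul_ne_zero hm.ne' hα
        have := sq_pos_of_ne_zero this
        simpa using this
      · have := sq_pos_of_ne_zero h0
        positivity
    exact pos_of_mul_pos_right h5 hm.le
  have ha'0 : 0 < a' := by
    by_contra hneg
    nlinarith [sq_nonneg l]
  have hlt : a' < a := by
    by_contra hge
    have h6 : 3 * a ^ 2 ≤ 4 * g := by nlinarith
    have h7 : (3 * a ^ 2) ^ 2 ≤ (4 * g) ^ 2 := by gcongr
    nlinarith [pow_le_pow_left₀ (by norm_num) h2 3]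
  exact ⟨t, α, β, γ, δ, a', l, hu, hl, ha', ha'0, hlt, by linarith⟩

/-- A positive definite ternary form of determinant `3` is represented by
`x² + y² + 3z²` or by `x² + 2y² + 2yz + 2z²`. -/
lemma ternary_form_det_three (n : ℕ) : ∀ a b c d e f : ℤ, a.toNat ≤ n → 0 < a → 0 < a * b - d ^ 2 →
    a * b * c + 2 * d * e * f - a * f ^ 2 - b * e ^ 2 - c * d ^ 2 = 3 →
    ∃ M : Matrix (Fin 3) (Fin 3) ℤ,
      !![a, d, e; d, b, f; e, f, c] = Mᵀ * !![1, 0, 0; 0, 1, 0; 0, 0, 3] * M ∨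
      !![a, d, e; d, b, f; e, f, c] = Mᵀ * !![1, 0, 0; 0, 2, 1; 0, 1, 2] * M := by
  induction n with
  | zero => intro a b c d e f hn hp; omega
  | succ n ih =>
    intro a b c d e f hn ha hm hdet
    rcases (by omega : a = 1 ∨ 2 ≤ a) with rfl | h2
    · obtain ⟨x₁, y₁, x₂, y₂, h⟩ := binary_form_det_three (b - d ^ 2).toNat (b - d ^ 2) (f - d * e)
        (c - e ^ 2) le_rfl (by linarith) (by linear_combination hdet)
      refine ⟨!![1, d, e; 0, x₁, x₂; 0, y₁, y₂], ?_⟩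
      rcases h with ⟨h₁, h₂, h₃⟩ | ⟨h₁, h₂, h₃⟩
      · left
        ext i j
        fin_cases i <;> fin_cases j <;> simp [Matrix.mul_apply, Fin.sum_univ_three] <;>
          first | linear_combination h₁ | linear_combination h₂ | linear_combination h₃
      · right
        ext i j
        fin_cases i <;> fin_cases j <;> simp [Matrix.mul_apply, Fin.sum_univ_three] <;>
          first | linear_combination h₁ | linear_combination h₂ | linear_combination h₃
    · obtain ⟨t, α, β, γ, δ, a', l, hu, hl, ha', ha'0, hlt, hminor⟩ :=
        exists_smaller_value_ternary_form a b c d e f h2 hm hdet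
      have hUV := change_basis_mul_inverse t α β γ δ hu
      have hUA := gram_change_basis a b c d e f t α β γ δ
      rw [← ha', ← hl] at hUA
      obtain ⟨M, hM⟩ := ih a' a (b * β ^ 2 + 2 * f * β * δ + c * δ ^ 2) (-l)
        (t * (d * β + e * δ) + b * α * β + f * (α * δ + β * γ) + c * γ * δ) (-(d * β + e * δ))
        (by omega) ha'0 (by linarith) (by
          rw [hl, ha']
          linear_combination (α * δ - β * γ) ^ 2 * hdet + 3 * (α * δ - β * γ + 1) * hu)
      rw [hUA] at hM
      exact ⟨_, hM.imp (eq_gram_mul_of_mul_eq_one hUV) (eq_gram_mul_of_mul_eq_one hUV)⟩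

lemma jacobiSym_three_eq_neg_one {m : ℕ} (h4 : m % 4 = 3) (h3 : m % 3 = 1) :
    jacobiSym 3 m = -1 := by
  have h := jacobiSym.quadratic_reciprocity_three_mod_four (a := 3) (b := m) (by norm_num) h4
  have h1 : jacobiSym (m : ℤ) 3 = 1 := by
    rw [jacobiSym.mod_left, (by omega : (m : ℤ) % (3 : ℕ) = 1), jacobiSym.one_left]
  rw [h1] at h
  exact_mod_cast h

lemma jacobiSym_neg_one_eq_neg_one {m : ℕ} (h4 : m % 4 = 3) : jacobiSym (-1) m = -1 := by
  rw [jacobiSym.at_neg_one (by rw [Nat.odd_iff]; omega), ZMod.χ₄_nat_three_mod_four h4]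

lemma exists_dvd_sq_add_of_jacobiSym_eq_one {q : ℕ} (hq : q.Prime) {D : ℤ}
    (h : jacobiSym (-D) q = 1) : ∃ x : ℤ, (q : ℤ) ∣ x ^ 2 + D := by
  have := Fact.mk hq
  rw [← jacobiSym.legendreSym.to_jacobiSym] at h
  have h0 : ((-D : ℤ) : ZMod q) ≠ 0 := by
    intro h0
    rw [(legendreSym.eq_zero_iff q (-D)).2 h0] at h
    exact zero_ne_one h
  obtain ⟨y, hy⟩ := (legendreSym.eq_one_iff q h0).1 h
  obtain ⟨x, rfl⟩ := ZMod.intCast_surjective y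
  refine ⟨x, (ZMod.intCast_zmod_eq_zero_iff_dvd _ q).1 ?_⟩
  push_cast at hy ⊢
  rw [pow_two, ← hy]
  ring

/-- The key reciprocity computation. -/
lemma jacobiSym_neg_eq_one {m q : ℕ} (h4 : m % 4 = 3) (h3 : m % 3 = 1) (hq : Odd q)
    {D : ℤ} (hD : D * m = 3 * q + 1) : jacobiSym (-D) q = 1 := by
  have hqm : jacobiSym q m = 1 := by
    have h1 : jacobiSym (3 * q) m = jacobiSym (-1) m := by
      rw [jacobiSym.mod_left, jacobiSym.mod_left (-1)]
      congr 1
      apply Int.ModEq.symm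
      rw [Int.modEq_iff_dvd]
      exact ⟨D, by linarith⟩
    rw [jacobiSym.mul_left, jacobiSym_three_eq_neg_one h4 h3, jacobiSym_neg_one_eq_neg_one h4] at h1
    linarith
  have h2 : jacobiSym (-D) q * jacobiSym m q = jacobiSym (-1) q := by
    rw [← jacobiSym.mul_left, jacobiSym.mod_left, jacobiSym.mod_left (-1)]
    congr 1
    apply Int.ModEq.symm
    rw [Int.modEq_iff_dvd]
    exact ⟨-3, by linarith⟩
  rcases Nat.odd_mod_four_iff.1 (Nat.odd_iff.1 hq) with hq4 | hq4
  · rw [← jacobiSym.quadratic_reciprocity_one_mod_four hq4 (by rw [Nat.odd_iff]; omega), hqm,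
      jacobiSym.at_neg_one hq, ZMod.χ₄_nat_one_mod_four hq4] at h2
    linarith
  · rw [jacobiSym.quadratic_reciprocity_three_mod_four h4 hq4, hqm,
      jacobiSym_neg_one_eq_neg_one hq4] at h2
    linarith

lemma exists_sq_add_three_mul_sq_add_three_mul_sq (n : ℕ) :
    ∃ a b c : ℤ, 3 * a ^ 2 + 3 * b ^ 2 + c ^ 2 = 24 * n + 7 := by
  have hunit : IsUnit ((8 * n + 2 : ℕ) : ZMod (24 * n + 7)) := by
    rw [ZMod.isUnit_iff_coprime]
    have h : 24 * n + 7 = 1 + 3 * (8 * n + 2) := by ring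
    rw [h, Nat.coprime_add_mul_right_right]
    simp
  obtain ⟨q, hq2, hqp, hqm⟩ := Nat.forall_exists_prime_gt_and_eq_mod hunit 2
  have hodd : Odd q := hqp.odd_of_ne_two (by omega)
  have hdvd : (24 * n + 7) ∣ 3 * q + 1 := by
    rw [← ZMod.natCast_eq_zero_iff]
    push_cast
    rw [hqm]
    have := ZMod.natCast_self (24 * n + 7)
    push_cast at this ⊢
    linear_combination this
  obtain ⟨D, hD⟩ := hdvd
  have hDz : (D : ℤ) * (24 * n + 7 : ℕ) = 3 * q + 1 := by
    have : ((3 * q + 1 : ℕ) : ℤ) = ((24 * n + 7) * D : ℕ) := by rw [hD]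
    push_cast at this ⊢
    linarith
  obtain ⟨x, a, hx⟩ := exists_dvd_sq_add_of_jacobiSym_eq_one hqp
    (jacobiSym_neg_eq_one (by omega) (by omega) hodd hDz)
  push_cast at hDz
  have hD0 : 0 < (D : ℤ) := by
    have : D ≠ 0 := by rintro rfl; omega
    omega
  have hq0 : 0 < (q : ℤ) := by omega
  have ha : 0 < a := by
    by_contra h
    nlinarith [sq_nonneg x]
  obtain ⟨M, hM⟩ := ternary_form_det_three a.toNat a q (3 * (24 * n + 7)) x 3 0 le_rfl ha
    (by linarith) (by linear_combination 3 * hDz - 3 * (24 * n + 7) * hx)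
  rcases hM with hM | hM
  · have h := congrFun (congrFun hM 2) 2
    simp [Matrix.mul_apply, Fin.sum_univ_three] at h
    have key : ∀ u v w k : ℤ, 3 * k = u ^ 2 + v ^ 2 + 3 * w ^ 2 →
        ∃ a b c : ℤ, 3 * a ^ 2 + 3 * b ^ 2 + c ^ 2 = k := by
      intro u v w k hk
      have hz : ∀ u v : ZMod 3, u ^ 2 + v ^ 2 = 0 → u = 0 ∧ v = 0 := by decide
      have h3 : ((3 : ℤ) : ZMod 3) = 0 := rfl
      have hk' := congrArg (Int.cast : ℤ → ZMod 3) hk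
      push_cast at hk' h3
      rw [h3] at hk'
      obtain ⟨hu, hv⟩ := hz u v (by linear_combination -hk')
      obtain ⟨u, rfl⟩ := (ZMod.intCast_zmod_eq_zero_iff_dvd u 3).1 hu
      obtain ⟨v, rfl⟩ := (ZMod.intCast_zmod_eq_zero_iff_dvd v 3).1 hv
      exact ⟨u, v, w, by push_cast at hk; linarith⟩
    exact key (M 0 2) (M 1 2) (M 2 2) _ (by linear_combination h)
  · exfalso
    have h00 := congrFun (congrFun hM 0) 0
    have h01 := congrFun (congrFun hM 0) 1
    have h11 := congrFun (congrFun hM 1) 1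
    simp [Matrix.mul_apply, Fin.sum_univ_three] at h00 h01 h11
    have hmod : ∀ x₁ y₁ z₁ x₂ y₂ z₂ : ZMod 3,
        (x₁ ^ 2 - (y₁ - z₁) ^ 2) * (x₂ ^ 2 - (y₂ - z₂) ^ 2)
          - (x₁ * x₂ - (y₁ - z₁) * (y₂ - z₂)) ^ 2 ≠ 1 := by
      intro x₁ y₁ z₁ x₂ y₂ z₂ h
      have h' : ∀ s : ZMod 3, -s ^ 2 ≠ 1 := by decide
      exact h' (x₁ * (y₂ - z₂) - x₂ * (y₁ - z₁)) (by linear_combination h)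
    have h3 : (3 : ZMod 3) = 0 := rfl
    apply hmod (M 0 0) (M 1 0) (M 2 0) (M 0 1) (M 1 1) (M 2 1)
    have c00 := congrArg (Int.cast : ℤ → ZMod 3) h00
    have c01 := congrArg (Int.cast : ℤ → ZMod 3) h01
    have c11 := congrArg (Int.cast : ℤ → ZMod 3) h11
    have cx := congrArg (Int.cast : ℤ → ZMod 3) hx
    have cD := congrArg (Int.cast : ℤ → ZMod 3) hDz
    push_cast at c00 c01 c11 cx cD
    have e00 : (a : ZMod 3) = (M 0 0 : ZMod 3) ^ 2 - ((M 1 0 : ZMod 3) - M 2 0) ^ 2 := by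
      linear_combination c00 + h3 * ((M 1 0 : ZMod 3) ^ 2 + (M 2 0 : ZMod 3) ^ 2)
    have e01 : (x : ZMod 3) = (M 0 0 : ZMod 3) * M 0 1
        - ((M 1 0 : ZMod 3) - M 2 0) * ((M 1 1 : ZMod 3) - M 2 1) := by
      linear_combination c01 + h3 * ((M 1 0 : ZMod 3) * M 1 1 + (M 2 0 : ZMod 3) * M 2 1)
    have e11 : (q : ZMod 3) = (M 0 1 : ZMod 3) ^ 2 - ((M 1 1 : ZMod 3) - M 2 1) ^ 2 := by
      linear_combination c11 + h3 * ((M 1 1 : ZMod 3) ^ 2 + (M 2 1 : ZMod 3) ^ 2)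
    rw [← e00, ← e01, ← e11]
    linear_combination -cx + cD - h3 * (8 * n * D + 2 * D - q)

lemma exists_odd_rep (n : ℕ) : ∃ a b c : ℤ, Odd a ∧ Odd b ∧ Odd c ∧
    3 * a ^ 2 + 3 * b ^ 2 + c ^ 2 = 24 * n + 7 := by
  have even_case : ∀ a b c : ℤ, Even b → Even c → 3 * a ^ 2 + 3 * b ^ 2 + c ^ 2 = 24 * n + 7 →
      ∃ a b c : ℤ, Odd a ∧ Odd b ∧ Odd c ∧ 3 * a ^ 2 + 3 * b ^ 2 + c ^ 2 = 24 * n + 7 := by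
    rintro a b c hb hc h
    obtain ⟨b, rfl⟩ := hb.two_dvd
    obtain ⟨c, rfl⟩ := hc.two_dvd
    have ha : Odd a := by
      by_contra ha
      obtain ⟨a, rfl⟩ := (Int.not_odd_iff_even.1 ha).two_dvd
      have : 2 * (6 * a ^ 2 + 6 * b ^ 2 + 2 * c ^ 2 - 12 * n) = 7 := by linarith
      omega
    have hbc : Odd (c + b) := by
      by_contra hbc
      obtain ⟨k, hk⟩ := (Int.not_odd_iff_even.1 hbc).two_dvd
      obtain rfl : c = 2 * k - b := by linarith
      have h8 := Int.eight_dvd_sq_sub_one_of_odd ha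
      obtain ⟨s, hs⟩ := h8
      have : 8 * (3 * s + 2 * b ^ 2 + 2 * k ^ 2 - 2 * k * b - 3 * n) = 4 := by linarith
      omega
    refine ⟨a, c - b, c + 3 * b, ha, ?_, ?_, by linarith⟩
    · grind
    · grind
  obtain ⟨a, b, c, h⟩ := exists_sq_add_three_mul_sq_add_three_mul_sq n
  rcases Int.even_or_odd a with ha | ha <;> rcases Int.even_or_odd b with hb | hb <;>
    rcases Int.even_or_odd c with hc | hc
  case inr.inr.inr => exact ⟨a, b, c, ha, hb, hc, h⟩
  case inr.inl.inl => exact even_case a b c hb hc h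
  case inl.inr.inl => exact even_case b a c ha hc (by linarith)
  all_goals
    exfalso
    obtain ⟨a, rfl⟩ := ha
    obtain ⟨b, rfl⟩ := hb
    obtain ⟨c, rfl⟩ := hc
    ring_nf at h
    omega

/-- Starting from a representation with `a² ≠ c²`, one obtains one in which `c` has a prescribed
class modulo `12`, by repeatedly replacing `(a, c)` by `(c - 2k, -c + 6k)`, where `a = -c + 4k`. -/
lemma exists_rep_of_not_pow_dvd (m : ℤ) (i : ℕ) : ∀ a b c : ℤ, Odd a → Odd b → Odd c → ¬ 3 ∣ c →
    3 * a ^ 2 + 3 * b ^ 2 + c ^ 2 = m → ¬ 2 ^ (i + 4) ∣ c ^ 2 - a ^ 2 →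
    ∃ a b c : ℤ, Odd a ∧ Odd b ∧ (c % 12 = 1 ∨ c % 12 = 11) ∧
      3 * a ^ 2 + 3 * b ^ 2 + c ^ 2 = m := by
  have param : ∀ a c : ℤ, Odd a → Odd c → ∃ k : ℤ, a ^ 2 = (-c + 4 * k) ^ 2 := by
    rintro a c ⟨u, rfl⟩ ⟨v, rfl⟩
    rcases Int.even_or_odd' (u + v) with ⟨w, hw | hw⟩
    · exact ⟨v - w, by obtain rfl : u = 2 * w - v := by linarith
                       ring⟩
    · exact ⟨w + 1, by obtain rfl : u = 2 * w + 1 - v := by linarith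
                       ring⟩
  induction i with
  | zero =>
    intro a b c ha hb hc h3 h hdvd
    obtain ⟨k, hk⟩ := param a c ha hc
    by_cases hc12 : c % 12 = 1 ∨ c % 12 = 11
    · exact ⟨a, b, c, ha, hb, hc12, h⟩
    · have hkodd : Odd k := by
        by_contra hke
        obtain ⟨l, rfl⟩ := (Int.not_odd_iff_even.1 hke).two_dvd
        exact hdvd ⟨l * (c - 4 * l), by rw [hk]; ring⟩
      refine ⟨c - 2 * k, b, -c + 6 * k, by grind, hb, ?_, ?_⟩
      · obtain ⟨u, rfl⟩ := hc
        obtain ⟨l, rfl⟩ := hkodd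
        have : (2 * u + 1) % 12 = 5 ∨ (2 * u + 1) % 12 = 7 := by
          have h0 : (2 * u + 1) % 12 ≠ 3 := by omega
          have h1 : (2 * u + 1) % 12 ≠ 9 := by omega
          omega
        omega
      · rw [← h, hk]; ring
  | succ i ih =>
    intro a b c ha hb hc h3 h hdvd
    by_cases hca : (2 : ℤ) ^ (i + 4) ∣ c ^ 2 - a ^ 2
    swap
    · exact ih a b c ha hb hc h3 h hca
    by_cases hcb : (2 : ℤ) ^ (i + 4) ∣ c ^ 2 - b ^ 2
    swap
    · exact ih b a c hb ha hc h3 (by linarith) hcb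
    obtain ⟨k, hk⟩ := param a c ha hc
    have hkeven : Even k := by
      by_contra hko
      obtain ⟨l, rfl⟩ := Int.not_even_iff_odd.1 hko
      have h16 : (16 : ℤ) ∣ c ^ 2 - a ^ 2 := dvd_trans ⟨2 ^ i, by rw [pow_add]; ring⟩ hca
      obtain ⟨s, hs⟩ := h16
      obtain ⟨u, rfl⟩ := hc
      rw [hk] at hs
      ring_nf at hs
      omega
    refine ih b (c - 2 * k) (-c + 6 * k) hb (by grind) (by grind) (by omega)
      (by rw [← h, hk]; ring) ?_
    intro hnew
    have hsub := dvd_sub hcb hnew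
    have e1 : c ^ 2 - b ^ 2 - ((-c + 6 * k) ^ 2 - b ^ 2) = 2 ^ 2 * (3 * (c - 3 * k) * k) := by ring
    rw [e1, (by ring : (2 : ℤ) ^ (i + 4) = 2 ^ 2 * 2 ^ (i + 2)),
      mul_dvd_mul_iff_left (by norm_num)] at hsub
    have hcop : IsCoprime ((2 : ℤ) ^ (i + 2)) (3 * (c - 3 * k)) := by
      apply IsCoprime.pow_left
      have hodd : Odd (3 * (c - 3 * k)) := by grind
      obtain ⟨w, hw⟩ := hodd
      exact ⟨-w, 1, by rw [hw]; ring⟩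
    obtain ⟨s, hs⟩ := hcop.dvd_of_dvd_mul_left hsub
    apply hdvd
    exact ⟨s * (c - 2 * k), by rw [hk]; linear_combination 8 * (c - 2 * k) * hs⟩

/-- `7p²` has a representation in which the three squares are not all equal. -/
lemma exists_rep_seven_mul_prime_sq {p : ℕ} (hp : p.Prime) (h12 : p % 12 = 5 ∨ p % 12 = 7) :
    ∃ a b c : ℤ, Odd a ∧ Odd b ∧ Odd c ∧ 3 * a ^ 2 + 3 * b ^ 2 + c ^ 2 = 7 * p ^ 2 ∧
      c ^ 2 - a ^ 2 ≠ 0 := by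
  have := Fact.mk hp
  have hpp : Prime (p : ℤ) := Nat.prime_iff_prime_int.1 hp
  have hpodd : Odd (p : ℤ) := by
    rw [Int.odd_iff]; omega
  have hnsq : ∀ x : ℤ, (p : ℤ) ≠ x ^ 2 := by
    intro x hx
    exact hpp.irreducible.not_isSquare ⟨x, by rw [hx, pow_two]⟩
  rcases h12 with h | h
  · obtain ⟨x, y, hxy⟩ := Nat.Prime.sq_add_sq (p := p) (by omega)
    have hz : (x : ℤ) ^ 2 + (y : ℤ) ^ 2 = p := by exact_mod_cast hxy
    generalize (x : ℤ) = x at hz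
    generalize (y : ℤ) = y at hz
    have hodd : Odd (x ^ 2 - y ^ 2) := by
      rw [← hz] at hpodd
      grind
    refine ⟨x ^ 2 - y ^ 2 - 2 * x * y, x ^ 2 - y ^ 2 + 2 * x * y, p, ?_, ?_, hpodd, ?_, ?_⟩
    · grind
    · grind
    · rw [← hz]; ring
    · intro h0
      have h1 : 4 * x * y * (x ^ 2 - y ^ 2) = 0 := by
        rw [← hz] at h0
        linear_combination h0
      have hx : x ≠ 0 := by rintro rfl; exact hnsq y (by linarith)
      have hy : y ≠ 0 := by rintro rfl; exact hnsq x (by linarith)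
      have hxy : x ^ 2 - y ^ 2 ≠ 0 := by intro h; rw [h] at hodd; simp at hodd
      simp_all
  · have hjac : jacobiSym (-3) p = 1 := by
      rw [(by norm_num : (-3 : ℤ) = -1 * 3), jacobiSym.mul_left,
        jacobiSym_three_eq_neg_one (by omega) (by omega),
        jacobiSym_neg_one_eq_neg_one (by omega)]
      norm_num
    obtain ⟨r, s, hs⟩ := exists_dvd_sq_add_of_jacobiSym_eq_one hp hjac
    obtain ⟨x, y, _, _, ⟨hz, -⟩ | ⟨hz, -⟩⟩ := binary_form_det_three p p r s (by simp)
      (by omega) (by linarith)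
    swap
    · omega
    have hodd : Odd (x ^ 2 - 3 * y ^ 2) := by
      rw [hz] at hpodd
      grind
    refine ⟨x ^ 2 - 3 * y ^ 2 + 2 * x * y, p, x ^ 2 - 3 * y ^ 2 - 6 * x * y, ?_, hpodd, ?_, ?_, ?_⟩
    · grind
    · grind
    · rw [hz]; ring
    · intro h0
      have h1 : x * y * (x ^ 2 - 3 * y ^ 2 - 2 * x * y) = 0 := by
        linarith
      have hx : x ≠ 0 := by rintro rfl; omega
      have hy : y ≠ 0 := by rintro rfl; exact hnsq x (by linarith)
      have hxy : x ^ 2 - 3 * y ^ 2 - 2 * x * y ≠ 0 := by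
        intro h; grind
      simp_all

lemma exists_prime_dvd_mod_twelve (c : ℕ) (h : c % 12 = 5 ∨ c % 12 = 7) :
    ∃ p : ℕ, p.Prime ∧ (p % 12 = 5 ∨ p % 12 = 7) ∧ p ∣ c := by
  induction c using Nat.strong_induction_on with
  | _ c ih =>
    obtain ⟨p, hp, k, rfl⟩ := Nat.exists_prime_and_dvd (n := c) (by omega)
    by_cases hp12 : p % 12 = 5 ∨ p % 12 = 7
    · exact ⟨p, hp, hp12, dvd_mul_right p k⟩
    have hk : k % 12 = 5 ∨ k % 12 = 7 := by
      have key : ∀ u v : ZMod 12, (u * v = 5 ∨ u * v = 7) → (u = 5 ∨ u = 7) ∨ v = 5 ∨ v = 7 := by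
        decide
      have cast : ∀ u r : ℕ, r < 12 → (u % 12 = r ↔ (u : ZMod 12) = r) := by
        intro u r hr
        rw [ZMod.natCast_eq_natCast_iff', Nat.mod_eq_of_lt hr]
      rw [cast _ 5 (by norm_num), cast _ 7 (by norm_num)] at h hp12 ⊢
      push_cast at h hp12 ⊢
      exact (key _ _ h).resolve_left hp12
    have hk0 : 0 < k := by omega
    obtain ⟨r, hr, hr12, hrk⟩ := ih k (by nlinarith [hp.two_le]) hk
    exact ⟨r, hr, hr12, dvd_mul_of_dvd_right hrk p⟩

lemma exists_not_two_pow_dvd {x : ℤ} (hx : x ≠ 0) : ∃ i : ℕ, ¬ (2 : ℤ) ^ (i + 4) ∣ x := by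
  refine ⟨x.natAbs, fun h => ?_⟩
  have h1 := Int.le_of_dvd (abs_pos.2 hx) ((dvd_abs _ _).2 h)
  have h2 : x.natAbs < 2 ^ x.natAbs := Nat.lt_two_pow_self
  have h3 : |x| < 2 ^ x.natAbs := by
    rw [Int.abs_eq_natAbs]; exact_mod_cast h2
  have h4 : (2 : ℤ) ^ x.natAbs ≤ 2 ^ (x.natAbs + 4) := pow_le_pow_right₀ (by norm_num) (by omega)
  linarith

lemma exists_rep_mod_twelve (n : ℕ) : ∃ a b c : ℤ, Odd a ∧ Odd b ∧ (c % 12 = 1 ∨ c % 12 = 11) ∧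
    3 * a ^ 2 + 3 * b ^ 2 + c ^ 2 = 24 * n + 7 := by
  have not_dvd : ∀ a b c : ℤ, 3 * a ^ 2 + 3 * b ^ 2 + c ^ 2 = 24 * n + 7 → ¬ 3 ∣ c := by
    rintro a b _ h ⟨c, rfl⟩
    ring_nf at h
    omega
  have of_ne : ∀ a b c : ℤ, Odd a → Odd b → Odd c →
      3 * a ^ 2 + 3 * b ^ 2 + c ^ 2 = 24 * n + 7 → c ^ 2 - a ^ 2 ≠ 0 →
      ∃ a b c : ℤ, Odd a ∧ Odd b ∧ (c % 12 = 1 ∨ c % 12 = 11) ∧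
        3 * a ^ 2 + 3 * b ^ 2 + c ^ 2 = 24 * n + 7 := by
    intro a b c ha hb hc h hne
    obtain ⟨i, hi⟩ := exists_not_two_pow_dvd hne
    exact exists_rep_of_not_pow_dvd _ i a b c ha hb hc (not_dvd a b c h) h hi
  obtain ⟨a, b, c, ha, hb, hc, h⟩ := exists_odd_rep n
  by_cases hca : c ^ 2 - a ^ 2 = 0
  swap
  · exact of_ne a b c ha hb hc h hca
  by_cases hcb : c ^ 2 - b ^ 2 = 0
  swap
  · exact of_ne b a c hb ha hc (by linarith) hcb
  by_cases hc12 : c % 12 = 1 ∨ c % 12 = 11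
  · exact ⟨a, b, c, ha, hb, hc12, h⟩
  have h3 := not_dvd a b c h
  have hc57 : c % 12 = 5 ∨ c % 12 = 7 := by
    have h0 : c % 12 ≠ 3 := by omega
    have h1 : c % 12 ≠ 9 := by omega
    have h2 := Int.odd_iff.1 hc
    omega
  obtain ⟨p, hp, hp12, hpc⟩ := exists_prime_dvd_mod_twelve c.natAbs (by omega)
  obtain ⟨t, rfl⟩ := Int.natCast_dvd.2 hpc
  obtain ⟨u, v, w, hu, hv, hw, hrep, hne⟩ := exists_rep_seven_mul_prime_sq hp hp12
  have ht : Odd t := (Int.odd_mul.1 hc).2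
  have ht0 : t ≠ 0 := by rintro rfl; simp at ht
  refine of_ne (u * t) (v * t) (w * t) (hu.mul ht) (hv.mul ht) (hw.mul ht) ?_ ?_
  · linear_combination t ^ 2 * hrep + h + 3 * hca + 3 * hcb
  · rw [mul_pow, mul_pow, ← sub_mul]
    exact mul_ne_zero hne (pow_ne_zero 2 ht0)

lemma exists_sq_eq_of_odd {a : ℤ} (ha : Odd a) : ∃ x : ℤ, a ^ 2 = (4 * x + 1) ^ 2 := by
  obtain ⟨u, rfl⟩ := ha
  rcases Int.even_or_odd' u with ⟨w, rfl | rfl⟩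
  · exact ⟨w, by ring⟩
  · exact ⟨-w - 1, by ring⟩

/-- For every non negative integer `n`, the equation
`3(4x+1)² + 3(4y+1)² + (12z+1)² = 24n + 7` has an integer solution `x, y, z`. -/
theorem rep_24n_7 (n : ℤ) (hn : 0 ≤ n) :
    ∃ x y z : ℤ,
      3 * (4 * x + 1) ^ 2 + 3 * (4 * y + 1) ^ 2 + (12 * z + 1) ^ 2 = 24 * n + 7 := by
  lift n to ℕ using hn
  obtain ⟨a, b, c, ha, hb, hc, h⟩ := exists_rep_mod_twelve n
  obtain ⟨x, hx⟩ := exists_sq_eq_of_odd ha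
  obtain ⟨y, hy⟩ := exists_sq_eq_of_odd hb
  obtain ⟨z, hz⟩ : ∃ z : ℤ, c ^ 2 = (12 * z + 1) ^ 2 := by
    rcases hc with hc | hc
    · exact ⟨c / 12, by rw [(by omega : 12 * (c / 12) + 1 = c)]⟩
    · exact ⟨-(c / 12) - 1, by rw [(by omega : 12 * (-(c / 12) - 1) + 1 = -c), neg_sq]⟩
  exact ⟨x, y, z, by rw [← hx, ← hy, ← hz, h]⟩
end

section
/- For every non negative integer n, the equation 15(4x+1)² + 10(6y+1)² + 6(10z+1)² = 120n + 31 has an integer solution x, y, z. -/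
theorem exists_sq_add_eq_mul (n : ℕ) :
    ∃ a b c d : ℤ, 0 < a ∧ 0 < d ∧ d % 3 = 1 ∧ a * c - b ^ 2 = d ∧
      (120 * n + 31) * d = 3 * c + 1 := by
  have hcop : (20 * n + 5).Coprime (4 * (120 * n + 31)) := by
    refine Nat.Coprime.mul_right ?_ ?_
    · rw [show 20 * n + 5 = 1 + 4 * (5 * n + 1) by ring]
      simp
    · rw [show 120 * n + 31 = 1 + (20 * n + 5) * 6 by ring]
      simp
  obtain ⟨p, hgt, hp, hmod⟩ :=
    Nat.forall_exists_prime_gt_and_modEq (20 * n + 5) (by omega) hcop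
  obtain ⟨k, hk⟩ := (Nat.modEq_iff_dvd' hgt.le).1 hmod.symm
  have hpk : p = 20 * n + 5 + 4 * (120 * n + 31) * k := by omega
  have : Fact p.Prime := ⟨hp⟩
  set d : ℕ := 24 * k + 1 with hd
  have hp4 : p % 4 = 1 := by
    rw [hpk, show 20 * n + 5 + 4 * (120 * n + 31) * k
      = 1 + 4 * (5 * n + 1 + (120 * n + 31) * k) by ring]
    simp
  have hdp : 6 * p + 1 = (120 * n + 31) * d := by rw [hpk, hd]; ring
  have hdo : Odd d := ⟨12 * k, by omega⟩
  have hpo : Odd p := Nat.odd_iff.2 (by omega)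
  have h6 : jacobiSym 6 d = 1 := by
    rw [show (6 : ℤ) = 2 * 3 by norm_num, jacobiSym.mul_left, jacobiSym.at_two hdo]
    have h3 : jacobiSym 3 d = 1 := by
      have := jacobiSym.quadratic_reciprocity_one_mod_four' (a := 3) (b := d) (by decide) (by omega)
      rw [Nat.cast_ofNat] at this
      rw [this, jacobiSym.mod_left, show ((d : ℤ) % (3 : ℕ)) = 1 by omega, jacobiSym.one_left]
    rw [h3, ZMod.χ₈_nat_mod_eight, show d % 8 = 1 by omega]
    decide
  have hneg : jacobiSym (-1) d = 1 := by
    rw [jacobiSym.at_neg_one hdo, ZMod.χ₄_nat_one_mod_four (by omega)]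
  have hpd : jacobiSym p d = 1 := by
    have h : jacobiSym (6 * p) d = jacobiSym (-1) d := by
      apply jacobiSym.mod_left'
      apply Int.emod_emod_of_dvd _ (dvd_refl _) |>.symm.trans
      rw [Int.emod_emod_of_dvd _ (dvd_refl _)]
      apply Int.ModEq.symm
      rw [Int.modEq_iff_dvd]
      exact ⟨120 * n + 31, by push_cast [← Int.natCast_inj] at hdp; linarith⟩
    rwa [jacobiSym.mul_left, h6, hneg, one_mul] at h
  have hneg_d : jacobiSym (-d) p = 1 := by
    rw [← neg_one_mul, jacobiSym.mul_left, jacobiSym.at_neg_one hpo,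
      ZMod.χ₄_nat_one_mod_four hp4, one_mul,
      ← jacobiSym.quadratic_reciprocity_one_mod_four hp4 hdo, hpd]
  obtain ⟨s, hs⟩ := ZMod.isSquare_of_jacobiSym_eq_one hneg_d
  obtain ⟨b₀, rfl⟩ := ZMod.intCast_surjective s
  have hb₀ : (p : ℤ) ∣ b₀ ^ 2 + d := by
    rw [← ZMod.intCast_zmod_eq_zero_iff_dvd]
    push_cast at hs ⊢
    linear_combination -hs
  obtain ⟨b, hbp, hb2⟩ : ∃ b : ℤ, (p : ℤ) ∣ b ^ 2 + d ∧ (2 : ℤ) ∣ b ^ 2 + d := by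
    have h2 : ∀ b : ℤ, b % 2 = 1 → (2 : ℤ) ∣ b ^ 2 + d := fun b hb => by
      obtain ⟨m, rfl⟩ : ∃ m, b = 2 * m + 1 := ⟨b / 2, by omega⟩
      exact ⟨2 * m ^ 2 + 2 * m + 12 * k + 1, by rw [hd]; push_cast; ring⟩
    rcases Int.emod_two_eq_zero_or_one b₀ with h | h
    · refine ⟨b₀ + p, ?_, h2 _ (by omega)⟩
      rw [show (b₀ + p) ^ 2 + (d : ℤ) = b₀ ^ 2 + d + p * (2 * b₀ + p) by ring]
      exact dvd_add hb₀ (dvd_mul_right _ _)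
    · exact ⟨b₀, hb₀, h2 _ h⟩
  have hcop2 : IsCoprime (2 : ℤ) p := by
    rw [Int.isCoprime_iff_gcd_eq_one]
    exact (Nat.coprime_two_left.2 hpo)
  obtain ⟨a, ha⟩ := hcop2.mul_dvd hb2 hbp
  have hp0 : (0 : ℤ) < p := by exact_mod_cast hp.pos
  have hd0 : (0 : ℤ) < d := by omega
  refine ⟨a, b, 2 * p, d, ?_, hd0, by omega, by linarith, ?_⟩
  · have : 0 < 2 * (p : ℤ) * a := by rw [← ha]; positivity
    exact pos_of_mul_pos_right this (by positivity)
  · push_cast [← Int.natCast_inj] at hdp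
    linarith

/-- The quadratic form with Gram matrix `!![A, r, s; r, B, t; s, t, C]` is positive definite of
determinant `3`, its reduction modulo `3` is anisotropic modulo its radical, and it represents
`M`. -/
def IsDetThreeRep (M A B C r s t : ℤ) : Prop :=
  0 < A ∧ 0 < A * B - r ^ 2 ∧
  A * B * C + 2 * r * s * t - A * t ^ 2 - B * s ^ 2 - C * r ^ 2 = 3 ∧
  (∀ X Y Z : ℤ, 3 ∣ A * X ^ 2 + B * Y ^ 2 + C * Z ^ 2 + 2 * r * X * Y + 2 * s * X * Z
      + 2 * t * Y * Z →
    3 ∣ A * X + r * Y + s * Z ∧ 3 ∣ r * X + B * Y + t * Z ∧ 3 ∣ s * X + t * Y + C * Z) ∧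
  ∃ X Y Z : ℤ, M = A * X ^ 2 + B * Y ^ 2 + C * Z ^ 2 + 2 * r * X * Y + 2 * s * X * Z
      + 2 * t * Y * Z

namespace IsDetThreeRep

variable {M A B C r s t : ℤ}

theorem shift_two (h : IsDetThreeRep M A B C r s t) (k : ℤ) :
    IsDetThreeRep M A (B + 2 * k * r + k ^ 2 * A) C (r + k * A) s (t + k * s) := by
  obtain ⟨hA, hD, hdet, h3, X, Y, Z, hM⟩ := h
  refine ⟨hA, by linarith, by linarith, fun X Y Z hQ => ?_, X - k * Y, Y, Z, by rw [hM]; ring⟩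
  obtain ⟨h₁, h₂, h₃⟩ := h3 (X + k * Y) Y Z (by convert hQ using 1; ring)
  refine ⟨?_, ?_, ?_⟩
  · convert h₁ using 1; ring
  · obtain ⟨u, hu⟩ := h₁
    obtain ⟨v, hv⟩ := h₂
    exact ⟨v + k * u, by linear_combination hv + k * hu⟩
  · convert h₃ using 1; ring

theorem shift_three (h : IsDetThreeRep M A B C r s t) (k l : ℤ) :
    IsDetThreeRep M A B (C + 2 * k * t + 2 * l * s + 2 * k * l * r + k ^ 2 * B + l ^ 2 * A) r
      (s + k * r + l * A) (t + k * B + l * r) := by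
  obtain ⟨hA, hD, hdet, h3, X, Y, Z, hM⟩ := h
  refine ⟨hA, by linarith, by linarith, fun X Y Z hQ => ?_, X - l * Z, Y - k * Z, Z,
    by rw [hM]; ring⟩
  obtain ⟨h₁, h₂, h₃⟩ := h3 (X + l * Z) (Y + k * Z) Z (by convert hQ using 1; ring)
  refine ⟨?_, ?_, ?_⟩
  · convert h₁ using 1; ring
  · convert h₂ using 1; ring
  · obtain ⟨u, hu⟩ := h₁
    obtain ⟨v, hv⟩ := h₂
    obtain ⟨w, hw⟩ := h₃
    exact ⟨w + k * v + l * u, by linear_combination hw + k * hv + l * hu⟩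

theorem swap_one_two (h : IsDetThreeRep M A B C r s t) : IsDetThreeRep M B A C r t s := by
  obtain ⟨hA, hD, hdet, h3, X, Y, Z, hM⟩ := h
  have hB : 0 < B := by
    have : 0 < A * B := by nlinarith [sq_nonneg r]
    exact pos_of_mul_pos_right this hA.le
  refine ⟨hB, by linarith, by linarith, fun X Y Z hQ => ?_, Y, X, Z, by rw [hM]; ring⟩
  obtain ⟨h₁, h₂, h₃⟩ := h3 Y X Z (by convert hQ using 1; ring)
  refine ⟨?_, ?_, ?_⟩
  · convert h₂ using 1; ring
  · convert h₁ using 1; ring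
  · convert h₃ using 1; ring

theorem minor_mul_minor (h : IsDetThreeRep M A B C r s t) :
    (A * B - r ^ 2) * (A * C - s ^ 2) = 3 * A + (A * t - r * s) ^ 2 := by
  linear_combination A * h.2.2.1

theorem swap_two_three (h : IsDetThreeRep M A B C r s t) : IsDetThreeRep M A C B s r t := by
  have hmin := h.minor_mul_minor
  obtain ⟨hA, hD, hdet, h3, X, Y, Z, hM⟩ := h
  have hD' : 0 < A * C - s ^ 2 := by
    have : 0 < (A * B - r ^ 2) * (A * C - s ^ 2) := by rw [hmin]; positivity
    exact pos_of_mul_pos_right this hD.le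
  refine ⟨hA, hD', by linarith, fun X Y Z hQ => ?_, X, Z, Y, by rw [hM]; ring⟩
  obtain ⟨h₁, h₂, h₃⟩ := h3 X Z Y (by convert hQ using 1; ring)
  refine ⟨?_, ?_, ?_⟩
  · convert h₁ using 1; ring
  · convert h₃ using 1; ring
  · convert h₂ using 1; ring

end IsDetThreeRep

theorem exists_abs_two_mul_add_mul_le (r A : ℤ) (hA : 0 < A) : ∃ k : ℤ, |2 * (r + k * A)| ≤ A := by
  refine ⟨-((2 * r + A) / (2 * A)), ?_⟩
  have h₁ := Int.emod_add_mul_ediv (2 * r + A) (2 * A)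
  have h₂ := Int.emod_nonneg (2 * r + A) (show 2 * A ≠ 0 by omega)
  have h₃ := Int.emod_lt_of_pos (2 * r + A) (show 0 < 2 * A by omega)
  rw [abs_le]
  constructor <;> nlinarith

namespace IsDetThreeRep

variable {M A B C r s t : ℤ}

theorem exists_of_eq_one (h : IsDetThreeRep M 1 B C r s t) (hB : B - r ^ 2 ≤ 2) :
    ∃ X Y Z : ℤ, M = X ^ 2 + Y ^ 2 + 3 * Z ^ 2 := by
  obtain ⟨k, hk⟩ := exists_abs_two_mul_add_mul_le (t - r * s) (B - r ^ 2) (by linarith [h.2.1])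
  have h := ((h.shift_two (-r)).shift_three k (-s))
  obtain ⟨B', hB'⟩ : ∃ B', B' = B - r ^ 2 := ⟨_, rfl⟩
  obtain ⟨t', ht'⟩ : ∃ t', t' = t - r * s + k * (B - r ^ 2) := ⟨_, rfl⟩
  rw [← ht', ← hB'] at hk
  rw [show r + -r * 1 = 0 by ring, show s + k * 0 + -s * 1 = 0 by ring,
    show B + 2 * -r * r + (-r) ^ 2 * 1 = B' by rw [hB']; ring,
    show t + -r * s + k * B' + -s * 0 = t' by rw [ht', hB']; ring] at h
  generalize C + _ + _ + _ + _ + _ = C' at h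
  obtain ⟨-, hD, hdet, h3, X, Y, Z, hM⟩ := h
  have hB0 : 0 < B' := by linarith
  have hB2 : B' ≤ 2 := by linarith
  rw [abs_le] at hk
  have hdet' : B' * C' - t' ^ 2 = 3 := by linarith
  interval_cases B'
  · have : t' = 0 := by omega
    subst this
    have : C' = 3 := by linarith
    subst this
    exact ⟨X, Y, Z, by rw [hM]; ring⟩
  · exfalso
    have := (h3 1 1 0 (by norm_num)).1
    norm_num at this

theorem exists_eq (h : IsDetThreeRep M A B C r s t) :
    ∃ X Y Z : ℤ, M = X ^ 2 + Y ^ 2 + 3 * Z ^ 2 := by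
  induction hn : A.toNat using Nat.strong_induction_on generalizing A B C r s t with
  | _ n ihA =>
  induction hm : (A * B - r ^ 2).toNat using Nat.strong_induction_on generalizing B C r s t with
  | _ m ihD =>
  obtain ⟨k, hk⟩ := exists_abs_two_mul_add_mul_le r A h.1
  have h₁ := h.shift_two k
  rcases lt_or_ge (B + 2 * k * r + k ^ 2 * A) A with hlt | hge
  · exact ihA _ (by have := h₁.swap_one_two.1; omega) h₁.swap_one_two rfl
  obtain ⟨l, hl⟩ := exists_abs_two_mul_add_mul_le (A * t - r * s) (A * B - r ^ 2) h.2.1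
  have h₂ := h.shift_three l 0
  rcases lt_or_ge (A * (C + 2 * l * t + 2 * 0 * s + 2 * l * 0 * r + l ^ 2 * B + 0 ^ 2 * A)
      - (s + l * r + 0 * A) ^ 2) (A * B - r ^ 2) with hlt | hge'
  · exact ihD _ (by have := h₂.swap_two_three.2.1; omega) h₂.swap_two_three rfl
  have hmin := h₂.minor_mul_minor
  have hA := h.1
  have hD := h.2.1
  have hAD : 3 * A ^ 2 ≤ 4 * (A * B - r ^ 2) := by
    have := sq_le_sq' (abs_le.1 hk).1 (abs_le.1 hk).2
    nlinarith
  have hDA : (A * B - r ^ 2) ^ 2 ≤ 4 * A := by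
    have := sq_le_sq' (abs_le.1 hl).1 (abs_le.1 hl).2
    rw [show A * (t + l * B + 0 * r) - r * (s + l * r + 0 * A)
      = A * t - r * s + l * (A * B - r ^ 2) by ring] at hmin
    nlinarith
  generalize hDe : A * B - r ^ 2 = D at *
  have hA1 : A = 1 := by
    have : A < 2 := by
      by_contra! hA2
      have h₃ : 3 * A ≤ 2 * D := by nlinarith
      nlinarith
    omega
  subst hA1
  exact h.exists_of_eq_one (by nlinarith)

end IsDetThreeRep

theorem exists_eq_sq_add_three_mul {N a b c d : ℤ} (ha : 0 < a) (hd : 0 < d)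
    (hd3 : d % 3 = 1) (habc : a * c - b ^ 2 = d) (hN : N * d = 3 * c + 1) :
    ∃ u y z : ℤ, N = u ^ 2 + 3 * y ^ 2 + 3 * z ^ 2 := by
  have h : IsDetThreeRep (3 * N) a c (3 * N) b 3 0 := by
    refine ⟨ha, by linarith, by linear_combination 3 * N * habc + 3 * hN, fun X Y Z hQ => ?_,
      0, 0, 1, by ring⟩
    obtain ⟨q, hq⟩ := hQ
    have key : ∀ u v : ℤ, (3 : ℤ) ∣ u ^ 2 + d * v ^ 2 → (3 : ℤ) ∣ u := fun u v huv => by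
      rw [Int.dvd_iff_emod_eq_zero, pow_two, pow_two, Int.add_emod, Int.mul_emod d, hd3,
        Int.mul_emod u, Int.mul_emod v] at huv
      rw [Int.dvd_iff_emod_eq_zero]
      rcases (by omega : u % 3 = 0 ∨ u % 3 = 1 ∨ u % 3 = 2) with h | h | h <;>
      rcases (by omega : v % 3 = 0 ∨ v % 3 = 1 ∨ v % 3 = 2) with h' | h' | h' <;>
      simp [h, h'] at huv ⊢
    have h₁ := key (a * X + b * Y) Y
      ⟨a * (q - N * Z ^ 2 - 2 * X * Z), by rw [← habc]; linear_combination a * hq⟩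
    have h₂ := key (b * X + c * Y) X
      ⟨c * (q - N * Z ^ 2 - 2 * X * Z), by rw [← habc]; linear_combination c * hq⟩
    refine ⟨dvd_add h₁ (dvd_mul_right 3 Z), by simpa using h₂, ?_⟩
    exact ⟨X + N * Z, by ring⟩
  obtain ⟨X, Y, Z, hM⟩ := h.exists_eq
  have hXY : (X ^ 2 + Y ^ 2) % 3 = 0 := by omega
  have : X % 3 = 0 ∧ Y % 3 = 0 := by
    rw [pow_two, pow_two, Int.add_emod, Int.mul_emod X, Int.mul_emod Y] at hXY
    rcases (by omega : X % 3 = 0 ∨ X % 3 = 1 ∨ X % 3 = 2) with h | h | h <;>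
    rcases (by omega : Y % 3 = 0 ∨ Y % 3 = 1 ∨ Y % 3 = 2) with h' | h' | h' <;>
    simp [h, h'] at hXY ⊢
  obtain ⟨y, rfl⟩ := Int.dvd_of_emod_eq_zero this.1
  obtain ⟨z, rfl⟩ := Int.dvd_of_emod_eq_zero this.2
  exact ⟨Z, y, z, by linarith⟩

theorem exists_eq_three_mul_add_four_mul {N u y z : ℤ} (hN : N % 8 = 7)
    (h : N = u ^ 2 + 3 * y ^ 2 + 3 * z ^ 2) :
    ∃ z x w : ℤ, N = 3 * z ^ 2 + 4 * (x ^ 2 + x * w + w ^ 2) := by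
  have hcases : u % 2 = y % 2 ∨ u % 2 = z % 2 := by
    by_contra! hne
    rcases Int.emod_two_eq_zero_or_one u with hu | hu
    · obtain ⟨a, rfl⟩ : ∃ a, u = 2 * a := ⟨u / 2, by omega⟩
      obtain ⟨b, rfl⟩ : ∃ b, y = 2 * b + 1 := ⟨y / 2, by omega⟩
      obtain ⟨c, rfl⟩ : ∃ c, z = 2 * c + 1 := ⟨z / 2, by omega⟩
      ring_nf at h
      omega
    · obtain ⟨a, rfl⟩ : ∃ a, u = 2 * a + 1 := ⟨u / 2, by omega⟩
      obtain ⟨b, rfl⟩ : ∃ b, y = 2 * b := ⟨y / 2, by omega⟩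
      obtain ⟨c, rfl⟩ : ∃ c, z = 2 * c := ⟨z / 2, by omega⟩
      ring_nf at h
      omega
  rcases hcases with hp | hp
  · obtain ⟨x, rfl⟩ : ∃ x, u = 2 * x + y := ⟨(u - y) / 2, by omega⟩
    exact ⟨z, x, y, by rw [h]; ring⟩
  · obtain ⟨x, rfl⟩ : ∃ x, u = 2 * x + z := ⟨(u - z) / 2, by omega⟩
    exact ⟨y, x, z, by rw [h]; ring⟩

theorem exists_eq_fifteen_mul_add_four_mul {N z x w : ℤ} (hN : N % 5 = 1)
    (h : N = 3 * z ^ 2 + 4 * (x ^ 2 + x * w + w ^ 2)) :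
    ∃ a x y : ℤ, N = 15 * a ^ 2 + 4 * (x ^ 2 + x * y + 4 * y ^ 2) := by
  have hcases : 5 ∣ z + 2 * x + 2 * w ∨ 5 ∣ z + 2 * x ∨ 5 ∣ z + 2 * w ∨ 5 ∣ z - 2 * w ∨
      5 ∣ z - 2 * x := by
    have key : ∀ z x w : ZMod 5, 3 * z ^ 2 + 4 * (x ^ 2 + x * w + w ^ 2) = 1 →
        z + 2 * x + 2 * w = 0 ∨ z + 2 * x = 0 ∨ z + 2 * w = 0 ∨ z - 2 * w = 0 ∨
        z - 2 * x = 0 := by decide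
    have h5 : (N : ZMod 5) = 1 := by
      rw [← Int.cast_one, ZMod.intCast_eq_intCast_iff]
      exact hN
    have := key z x w (by rw [← h5, h]; push_cast; ring)
    have hdvd : ∀ m : ℤ, 5 ∣ m ↔ (m : ZMod 5) = 0 := fun m =>
      (ZMod.intCast_zmod_eq_zero_iff_dvd m 5).symm
    simpa [hdvd] using this
  rcases hcases with ⟨k, hk⟩ | ⟨k, hk⟩ | ⟨k, hk⟩ | ⟨k, hk⟩ | ⟨k, hk⟩
  · obtain rfl : z = 5 * k - 2 * x - 2 * w := by linarith
    exact ⟨-k, k - x, -2 * k + x + w, by rw [h]; ring⟩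
  · obtain rfl : z = 5 * k - 2 * x := by linarith
    exact ⟨-k, k - x - w, -2 * k + x, by rw [h]; ring⟩
  · obtain rfl : z = 5 * k - 2 * w := by linarith
    exact ⟨-k, k + x, -2 * k + w, by rw [h]; ring⟩
  · obtain rfl : z = 5 * k + 2 * w := by linarith
    exact ⟨-k, k + x + w, -2 * k - w, by rw [h]; ring⟩
  · obtain rfl : z = 5 * k + 2 * x := by linarith
    exact ⟨-k, k - w, -2 * k - x, by rw [h]; ring⟩

/-- The dot product of two integer vectors. -/
def dot (u v : ℤ × ℤ × ℤ) : ℤ := u.1 * v.1 + u.2.1 * v.2.1 + u.2.2 * v.2.2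

/-- Data for a rational endomorphism of `ℚ³`: an integer matrix given by its rows, and a
denominator given as a product `p * q`. -/
structure RationalMap where
  /-- The first factor of the denominator. -/
  p : ℤ
  /-- The second factor of the denominator. -/
  q : ℤ
  /-- The first row. -/
  row₀ : ℤ × ℤ × ℤ
  /-- The second row. -/
  row₁ : ℤ × ℤ × ℤ
  /-- The third row. -/
  row₂ : ℤ × ℤ × ℤ

namespace RationalMap

/-- The map preserves the quadratic form `15 * a ^ 2 + 4 * (x ^ 2 + x * y + 4 * y ^ 2)`, and its
denominator is a divisor of `8` times a divisor of `5`. -/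
abbrev IsIsometry (T : RationalMap) : Prop :=
  T.p ∣ 8 ∧ T.q ∣ 5 ∧
  15 * T.row₀.1 ^ 2 + 4 * (T.row₁.1 ^ 2 + T.row₁.1 * T.row₂.1 + 4 * T.row₂.1 ^ 2)
    = 15 * (T.p * T.q) ^ 2 ∧
  15 * T.row₀.2.1 ^ 2 + 4 * (T.row₁.2.1 ^ 2 + T.row₁.2.1 * T.row₂.2.1 + 4 * T.row₂.2.1 ^ 2)
    = 4 * (T.p * T.q) ^ 2 ∧
  15 * T.row₀.2.2 ^ 2 + 4 * (T.row₁.2.2 ^ 2 + T.row₁.2.2 * T.row₂.2.2 + 4 * T.row₂.2.2 ^ 2)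
    = 16 * (T.p * T.q) ^ 2 ∧
  30 * T.row₀.1 * T.row₀.2.1 + 4 * (2 * T.row₁.1 * T.row₁.2.1 + T.row₁.1 * T.row₂.2.1
    + T.row₁.2.1 * T.row₂.1 + 8 * T.row₂.1 * T.row₂.2.1) = 0 ∧
  30 * T.row₀.1 * T.row₀.2.2 + 4 * (2 * T.row₁.1 * T.row₁.2.2 + T.row₁.1 * T.row₂.2.2
    + T.row₁.2.2 * T.row₂.1 + 8 * T.row₂.1 * T.row₂.2.2) = 0 ∧
  30 * T.row₀.2.1 * T.row₀.2.2 + 4 * (2 * T.row₁.2.1 * T.row₁.2.2 + T.row₁.2.1 * T.row₂.2.2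
    + T.row₁.2.2 * T.row₂.2.1 + 8 * T.row₂.2.1 * T.row₂.2.2) = 4 * (T.p * T.q) ^ 2

/-- The image of `r` is a vector `(a, 2 * x, 2 * y)` with `a`, `x` and `y` integral at `2`. -/
abbrev EvenAt (T : RationalMap) (r : ℤ × ℤ × ℤ) : Prop :=
  T.p ∣ dot T.row₀ r ∧ 2 * T.p ∣ dot T.row₁ r ∧ 2 * T.p ∣ dot T.row₂ r

/-- The image of `r` is integral at `5`. -/
abbrev IntegralAt (T : RationalMap) (r : ℤ × ℤ × ℤ) : Prop :=
  T.q ∣ dot T.row₀ r ∧ T.q ∣ dot T.row₁ r ∧ T.q ∣ dot T.row₂ r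

theorem exists_of_evenAt_of_integralAt {T : RationalMap} (hT : T.IsIsometry) {a x y : ℤ}
    (h2 : T.EvenAt (a, x, y)) (h5 : T.IntegralAt (a, x, y)) :
    ∃ a' x' y' : ℤ, 15 * a ^ 2 + 4 * (x ^ 2 + x * y + 4 * y ^ 2)
      = 15 * a' ^ 2 + 16 * (x' ^ 2 + x' * y' + 4 * y' ^ 2) := by
  obtain ⟨hp, hq, h₁, h₂, h₃, h₁₂, h₁₃, h₂₃⟩ := hT
  have hcop : IsCoprime (2 * T.p) T.q :=
    (show IsCoprime (2 * 8 : ℤ) 5 by norm_num).mono (mul_dvd_mul_left 2 hp) hq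
  obtain ⟨a', ha⟩ := (hcop.of_isCoprime_of_dvd_left (dvd_mul_left _ _)).mul_dvd h2.1 h5.1
  obtain ⟨x', hx⟩ := hcop.mul_dvd h2.2.1 h5.2.1
  obtain ⟨y', hy⟩ := hcop.mul_dvd h2.2.2 h5.2.2
  refine ⟨a', x', y', ?_⟩
  have hd : (T.p * T.q) ^ 2 ≠ 0 := by
    refine pow_ne_zero 2 (mul_ne_zero ?_ ?_)
    · rintro h
      rw [h] at hp
      norm_num at hp
    · rintro h
      rw [h] at hq
      norm_num at hq
  apply mul_left_cancel₀ hd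
  simp only [dot] at ha hx hy
  have key : (T.p * T.q) ^ 2 * (15 * a ^ 2 + 4 * (x ^ 2 + x * y + 4 * y ^ 2))
      = 15 * (T.row₀.1 * a + T.row₀.2.1 * x + T.row₀.2.2 * y) ^ 2
        + 4 * ((T.row₁.1 * a + T.row₁.2.1 * x + T.row₁.2.2 * y) ^ 2
          + (T.row₁.1 * a + T.row₁.2.1 * x + T.row₁.2.2 * y)
            * (T.row₂.1 * a + T.row₂.2.1 * x + T.row₂.2.2 * y)
          + 4 * (T.row₂.1 * a + T.row₂.2.1 * x + T.row₂.2.2 * y) ^ 2) := by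
    linear_combination -a ^ 2 * h₁ - x ^ 2 * h₂ - y ^ 2 * h₃ - a * x * h₁₂ - a * y * h₁₃
      - x * y * h₂₃
  rw [key, ha, hx, hy]
  ring

theorem dvd_dot_of_dvd_dot {m n u : ℤ} {w r s : ℤ × ℤ × ℤ} (hmn : m ∣ n) (hu : IsCoprime n u)
    (h₁ : n ∣ u * r.1 - s.1) (h₂ : n ∣ u * r.2.1 - s.2.1) (h₃ : n ∣ u * r.2.2 - s.2.2)
    (h : m ∣ dot w s) : m ∣ dot w r := by
  refine (hu.of_isCoprime_of_dvd_left hmn).dvd_of_dvd_mul_left ?_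
  have : u * dot w r = dot w s + (w.1 * (u * r.1 - s.1) + w.2.1 * (u * r.2.1 - s.2.1)
      + w.2.2 * (u * r.2.2 - s.2.2)) := by
    simp only [dot]
    ring
  rw [this]
  exact dvd_add h (hmn.trans (dvd_add (dvd_add (h₁.mul_left _) (h₂.mul_left _)) (h₃.mul_left _)))

theorem exists_of_residues {T : RationalMap} (hT : T.IsIsometry) {n u v a x y : ℤ}
    {s t : ℤ × ℤ × ℤ} (hn : 2 * T.p ∣ n) (hu : IsCoprime n u) (hv : IsCoprime 5 v)
    (h₁ : n ∣ u * a - s.1) (h₂ : n ∣ u * x - s.2.1) (h₃ : n ∣ u * y - s.2.2)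
    (h₄ : 5 ∣ v * a - t.1) (h₅ : 5 ∣ v * x - t.2.1) (h₆ : 5 ∣ v * y - t.2.2)
    (h2 : T.EvenAt s) (h5 : T.IntegralAt t) :
    ∃ a' x' y' : ℤ, 15 * a ^ 2 + 4 * (x ^ 2 + x * y + 4 * y ^ 2)
      = 15 * a' ^ 2 + 16 * (x' ^ 2 + x' * y' + 4 * y' ^ 2) :=
  exists_of_evenAt_of_integralAt hT
    ⟨dvd_dot_of_dvd_dot ((dvd_mul_left _ _).trans hn) hu h₁ h₂ h₃ h2.1,
      dvd_dot_of_dvd_dot hn hu h₁ h₂ h₃ h2.2.1, dvd_dot_of_dvd_dot hn hu h₁ h₂ h₃ h2.2.2⟩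
    ⟨dvd_dot_of_dvd_dot hT.2.1 hv h₄ h₅ h₆ h5.1, dvd_dot_of_dvd_dot hT.2.1 hv h₄ h₅ h₆ h5.2.1,
      dvd_dot_of_dvd_dot hT.2.1 hv h₄ h₅ h₆ h5.2.2⟩

/-- Isometries moving every vector of norm `31` modulo `40` into the sublattice `2 ∣ x`, `2 ∣ y`,
up to four projective classes modulo `20`. -/
def coarseIsometries : List RationalMap :=
  [ ⟨1, 1, (1, 0, 0), (0, 1, 1), (0, 0, -1)⟩,
    ⟨2, 1, (2, 0, 0), (0, 1, -3), (0, -1, -1)⟩,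
    ⟨2, 1, (2, 0, 0), (0, 1, 4), (0, -1, 0)⟩,
    ⟨1, 5, (1, -2, -4), (-6, -3, 4), (-3, 1, -3)⟩,
    ⟨1, 5, (1, -2, 2), (-6, -3, -7), (-3, 1, 4)⟩,
    ⟨1, 5, (3, -2, -2), (-7, -2, -7), (-1, -1, 4)⟩,
    ⟨1, 5, (3, -2, 0), (-7, -2, 5), (-1, -1, -5)⟩,
    ⟨2, 5, (6, 0, -8), (-14, 5, -8), (-2, -5, -4)⟩,
    ⟨2, 5, (6, 0, 8), (-14, 5, 13), (-2, -5, -1)⟩,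
    ⟨2, 5, (2, 4, -4), (-3, -6, -19), (-9, 2, 3)⟩,
    ⟨2, 5, (6, 4, 0), (-4, 4, 20), (-7, 2, -5)⟩,
    ⟨2, 5, (2, 4, 8), (-3, -6, 13), (-9, 2, -1)⟩,
    ⟨2, 5, (6, 4, 4), (-4, 4, -16), (-7, 2, 7)⟩,
    ⟨2, 5, (6, 0, -8), (-14, -5, -13), (-2, 5, 1)⟩,
    ⟨2, 5, (6, 0, 8), (-14, -5, 8), (-2, 5, 4)⟩,
    ⟨1, 5, (1, 2, -2), (-6, 3, 7), (-3, -1, -4)⟩,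
    ⟨1, 5, (1, 2, 4), (-6, 3, -4), (-3, -1, 3)⟩,
    ⟨1, 5, (3, 2, 0), (-7, 2, -5), (-1, 1, 5)⟩,
    ⟨1, 5, (3, 2, 2), (-7, 2, 7), (-1, 1, -4)⟩,
    ⟨2, 5, (2, -4, -8), (-3, 6, -13), (-9, -2, 1)⟩,
    ⟨2, 5, (2, -4, 4), (-3, 6, 19), (-9, -2, -3)⟩,
    ⟨2, 5, (6, -4, -4), (-4, -4, 16), (-7, -2, -7)⟩,
    ⟨2, 5, (6, -4, 0), (-4, -4, -20), (-7, -2, 5)⟩ ]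

/-- Isometries refining `coarseIsometries` on the projective class of `(1, 1, 1)` modulo `20`. -/
def fineIsometries : List RationalMap :=
  [ ⟨4, 1, (0, 0, -4), (8, 0, 0), (-1, -2, -1)⟩,
    ⟨4, 5, (4, -4, -20), (-6, -19, 5), (-18, 3, -5)⟩,
    ⟨8, 1, (0, -4, -4), (16, 0, 0), (-2, 1, -7)⟩,
    ⟨8, 5, (28, -8, 20), (57, 18, -35), (-9, 14, 35)⟩ ]

theorem isIsometry_of_mem_coarseIsometries :
    ∀ T ∈ coarseIsometries, T.IsIsometry ∧ 2 * T.p ∣ 4 := by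
  decide +kernel

theorem isIsometry_of_mem_fineIsometries :
    ∀ T ∈ fineIsometries, T.IsIsometry ∧ 2 * T.p ∣ 16 := by
  decide +kernel

theorem coarseIsometries_cover :
    ∀ X ∈ Finset.range 4, ∀ Y ∈ Finset.range 4, ∀ A ∈ Finset.range 5, ∀ C ∈ Finset.range 5,
      X * (X + Y) % 2 = 0 →
      (X, Y, A, C) ∈ [(2, 1, 1, 1), (2, 3, 4, 1), (1, 1, 4, 4), (3, 3, 1, 4)] ∨
      ∃ T ∈ coarseIsometries, T.EvenAt (1, (X : ℤ), (Y : ℤ)) ∧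
        T.IntegralAt ((A : ℤ), 2 * (C : ℤ) + 1, (C : ℤ)) := by
  decide +kernel

theorem fineIsometries_cover :
    ∀ X ∈ Finset.range 16, ∀ Y ∈ Finset.range 16, X % 4 = 1 → Y % 4 = 1 → (X = 1 ∧ Y = 1) ∨
      ∃ T ∈ fineIsometries, T.EvenAt (1, (X : ℤ), (Y : ℤ)) ∧ T.IntegralAt (1, 1, 1) := by
  decide +kernel

end RationalMap

/-- The vector `(a, x, y)` is congruent to a multiple of `(1, 1, 1)` modulo `n`. -/
def NearDiagonal (n a x y : ℤ) : Prop := n ∣ x - a ∧ n ∣ y - a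

theorem odd_of_eq_fifteen_mul {N a x y : ℤ} (hN : N % 8 = 7)
    (h : N = 15 * a ^ 2 + 4 * (x ^ 2 + x * y + 4 * y ^ 2)) :
    a % 2 = 1 ∧ x * (x + y) % 2 = 0 := by
  have ha : a % 2 = 1 := by
    by_contra hne
    obtain ⟨b, rfl⟩ : ∃ b, a = 2 * b := ⟨a / 2, by omega⟩
    ring_nf at h
    omega
  refine ⟨ha, ?_⟩
  obtain ⟨b, rfl⟩ : ∃ b, a = 2 * b + 1 := ⟨a / 2, by omega⟩
  obtain ⟨c, hc⟩ : ∃ c, b ^ 2 + b = 2 * c :=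
    (Int.even_mul_succ_self b).two_dvd.imp fun c hc => by linear_combination hc
  have h' : N = 120 * c + 15 + 4 * (x * (x + y)) + 16 * y ^ 2 := by
    linear_combination h + 60 * hc
  omega

theorem not_five_dvd_of_eq_fifteen_mul {N a x y : ℤ} (hN : N % 5 = 1)
    (h : N = 15 * a ^ 2 + 4 * (x ^ 2 + x * y + 4 * y ^ 2)) : ¬ 5 ∣ x - 2 * y := by
  rintro ⟨k, hk⟩
  obtain rfl : x = 5 * k + 2 * y := by linarith
  ring_nf at h
  omega

theorem sixteen_dvd_pow_three_mul_sub_one {a : ℤ} (ha : a % 2 = 1) : 16 ∣ a ^ 3 * a - 1 := by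
  have key : ∀ b : ZMod 16, (2 * b + 1) ^ 3 * (2 * b + 1) - 1 = 0 := by decide
  obtain ⟨b, rfl⟩ : ∃ b, a = 2 * b + 1 := ⟨a / 2, by omega⟩
  refine (ZMod.intCast_zmod_eq_zero_iff_dvd _ 16).1 ?_
  push_cast
  exact key b

theorem five_dvd_pow_three_mul_sub_one {a : ℤ} (ha : ¬ 5 ∣ a) : 5 ∣ a ^ 3 * a - 1 := by
  have key : ∀ b : ZMod 5, b ≠ 0 → b ^ 3 * b - 1 = 0 := by decide
  refine (ZMod.intCast_zmod_eq_zero_iff_dvd _ 5).1 ?_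
  push_cast
  exact key a fun h => ha ((ZMod.intCast_zmod_eq_zero_iff_dvd _ 5).1 h)

theorem isCoprime_of_dvd_mul_sub_one {n u a : ℤ} (h : n ∣ u * a - 1) : IsCoprime n u := by
  obtain ⟨k, hk⟩ := h
  exact ⟨-k, a, by linear_combination hk⟩

theorem exists_mem_range_dvd_sub (n : ℕ) (hn : 0 < n) (z : ℤ) :
    ∃ k ∈ Finset.range n, (n : ℤ) ∣ z - (k : ℤ) := by
  have h₁ := Int.emod_nonneg z (show (n : ℤ) ≠ 0 by omega)
  have h₂ := Int.emod_lt_of_pos z (show (0 : ℤ) < n by omega)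
  refine ⟨(z % n).toNat, Finset.mem_range.2 (by omega), ?_⟩
  rw [Int.toNat_of_nonneg h₁]
  exact Int.dvd_self_sub_emod

theorem exists_or_nearDiagonal {N a x y : ℤ} (hN : N % 120 = 31)
    (h : N = 15 * a ^ 2 + 4 * (x ^ 2 + x * y + 4 * y ^ 2)) :
    (∃ a' x' y' : ℤ, N = 15 * a' ^ 2 + 16 * (x' ^ 2 + x' * y' + 4 * y' ^ 2)) ∨
    NearDiagonal 20 a x y ∨ NearDiagonal 20 (-a) x y ∨ NearDiagonal 20 a (x + y) (-y) ∨
      NearDiagonal 20 (-a) (x + y) (-y) := by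
  obtain ⟨ha, hxy⟩ := odd_of_eq_fifteen_mul (by omega) h
  have hu : (4 : ℤ) ∣ a ^ 3 * a - 1 :=
    (show (4 : ℤ) ∣ 16 by norm_num).trans (sixteen_dvd_pow_three_mul_sub_one ha)
  have hv := five_dvd_pow_three_mul_sub_one (not_five_dvd_of_eq_fifteen_mul (by omega) h)
  generalize a ^ 3 = u at hu
  generalize (x - 2 * y) ^ 3 = v at hv
  have hu' := isCoprime_of_dvd_mul_sub_one hu
  have hv' := isCoprime_of_dvd_mul_sub_one hv
  obtain ⟨X, hX, hX'⟩ := exists_mem_range_dvd_sub 4 (by norm_num) (u * x)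
  obtain ⟨Y, hY, hY'⟩ := exists_mem_range_dvd_sub 4 (by norm_num) (u * y)
  obtain ⟨A, hA, hA'⟩ := exists_mem_range_dvd_sub 5 (by norm_num) (v * a)
  obtain ⟨C, hC, hC'⟩ := exists_mem_range_dvd_sub 5 (by norm_num) (v * y)
  push_cast at hX' hY' hA' hC'
  have hD' : 5 ∣ v * x - (2 * (C : ℤ) + 1) := by
    rw [mul_sub, mul_left_comm] at hv
    omega
  have hXY : X * (X + Y) % 2 = 0 := by
    have h₁ : (2 : ℤ) ∣ (u * x) * (u * x + u * y) :=
      ⟨u ^ 2 * (x * (x + y) / 2), by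
        linear_combination (-u ^ 2) * (Int.mul_ediv_cancel' (Int.dvd_of_emod_eq_zero hxy))⟩
    have h₂ : (2 : ℤ) ∣ (X : ℤ) * (X + Y) := by
      obtain ⟨i, hi⟩ := hX'
      obtain ⟨j, hj⟩ := hY'
      obtain ⟨k, hk⟩ := h₁
      rw [show u * x = X + 4 * i by linarith, show u * y = Y + 4 * j by linarith] at hk
      exact ⟨k - 4 * X * i - 2 * X * j - 2 * i * Y - 8 * i ^ 2 - 8 * i * j, by
        linear_combination hk⟩
    have h₃ : 2 ∣ X * (X + Y) := by exact_mod_cast h₂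
    omega
  rcases RationalMap.coarseIsometries_cover X hX Y hY A hA C hC hXY with hexc | ⟨T, hT, h2, h5⟩
  · right
    have h4 : ∀ z, (4 : ℤ) ∣ u * z → 4 ∣ z := fun z => hu'.dvd_of_dvd_mul_left
    have h5 : ∀ z, (5 : ℤ) ∣ v * z → 5 ∣ z := fun z => hv'.dvd_of_dvd_mul_left
    have e₁ := h4 (x - a)
    have e₂ := h4 (y - a)
    have e₃ := h4 (x + a)
    have e₄ := h4 (y + a)
    have e₅ := h4 (x + y - a)
    have e₆ := h4 (x + y + a)
    have f₁ := h5 (x - a)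
    have f₂ := h5 (y - a)
    have f₃ := h5 (x + a)
    have f₄ := h5 (y + a)
    have f₅ := h5 (x + y - a)
    have f₆ := h5 (x + y + a)
    simp only [mul_add, mul_sub] at e₁ e₂ e₃ e₄ e₅ e₆ f₁ f₂ f₃ f₄ f₅ f₆
    simp only [List.mem_cons, Prod.mk.injEq, List.not_mem_nil, or_false] at hexc
    simp only [NearDiagonal]
    rcases hexc with ⟨rfl, rfl, rfl, rfl⟩ | ⟨rfl, rfl, rfl, rfl⟩ | ⟨rfl, rfl, rfl, rfl⟩ |
      ⟨rfl, rfl, rfl, rfl⟩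
    · right; right; right
      push_cast at *
      have := e₆ (by omega)
      have := e₂ (by omega)
      have := f₆ (by omega)
      have := f₂ (by omega)
      omega
    · right; right; left
      push_cast at *
      have := e₅ (by omega)
      have := e₄ (by omega)
      have := f₅ (by omega)
      have := f₄ (by omega)
      omega
    · left
      push_cast at *
      have := e₁ (by omega)
      have := e₂ (by omega)
      have := f₁ (by omega)
      have := f₂ (by omega)
      omega
    · right; left
      push_cast at *
      have := e₃ (by omega)
      have := e₄ (by omega)
      have := f₃ (by omega)
      have := f₄ (by omega)
      omega
  · left
    rw [h]
    obtain ⟨hiso, hp⟩ := RationalMap.isIsometry_of_mem_coarseIsometries T hT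
    exact RationalMap.exists_of_residues hiso hp hu' hv' hu hX' hY' hA' hD' hC' h2 h5

theorem exists_or_nearDiagonal_of_nearDiagonal {N a x y : ℤ} (hN : N % 120 = 31)
    (h : N = 15 * a ^ 2 + 4 * (x ^ 2 + x * y + 4 * y ^ 2)) (hd : NearDiagonal 20 a x y) :
    (∃ a' x' y' : ℤ, N = 15 * a' ^ 2 + 16 * (x' ^ 2 + x' * y' + 4 * y' ^ 2)) ∨
    NearDiagonal 80 a x y := by
  obtain ⟨ha, -⟩ := odd_of_eq_fifteen_mul (by omega) h
  have h5 := not_five_dvd_of_eq_fifteen_mul (by omega) h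
  obtain ⟨hx, hy⟩ := hd
  have hu := sixteen_dvd_pow_three_mul_sub_one ha
  have hv := five_dvd_pow_three_mul_sub_one (show ¬ 5 ∣ a by omega)
  generalize a ^ 3 = u at hu hv
  have hu' := isCoprime_of_dvd_mul_sub_one hu
  have hv' := isCoprime_of_dvd_mul_sub_one hv
  have hux := hx.mul_left u
  have huy := hy.mul_left u
  rw [mul_sub] at hux huy
  obtain ⟨X, hX, hX'⟩ := exists_mem_range_dvd_sub 16 (by norm_num) (u * x)
  obtain ⟨Y, hY, hY'⟩ := exists_mem_range_dvd_sub 16 (by norm_num) (u * y)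
  push_cast at hX' hY'
  rcases RationalMap.fineIsometries_cover X hX Y hY (by omega) (by omega) with
    ⟨rfl, rfl⟩ | ⟨T, hT, h2, h5⟩
  · right
    push_cast at hX' hY'
    have h₁ : (16 : ℤ) ∣ x - a := hu'.dvd_of_dvd_mul_left (by rw [mul_sub]; omega)
    have h₂ : (16 : ℤ) ∣ y - a := hu'.dvd_of_dvd_mul_left (by rw [mul_sub]; omega)
    exact ⟨by omega, by omega⟩
  · left
    rw [h]
    obtain ⟨hiso, hp⟩ := RationalMap.isIsometry_of_mem_fineIsometries T hT
    exact RationalMap.exists_of_residues hiso hp hu' hv' hu hX' hY' hv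
      (t := (1, 1, 1)) (by dsimp only; omega) (by dsimp only; omega) h2 h5

/-- The rotations of infinite order about `(1, 1, 1)` cannot keep a vector off the axis congruent
to a multiple of `(1, 1, 1)` forever. -/
theorem exists_of_nearDiagonal {N a x y : ℤ} (hN : N % 120 = 31)
    (h : N = 15 * a ^ 2 + 4 * (x ^ 2 + x * y + 4 * y ^ 2)) (hd : NearDiagonal 20 a x y) :
    ∃ a' x' y' : ℤ, N = 15 * a' ^ 2 + 16 * (x' ^ 2 + x' * y' + 4 * y' ^ 2) := by
  by_contra hno
  have lift : ∀ {a x y : ℤ}, N = 15 * a ^ 2 + 4 * (x ^ 2 + x * y + 4 * y ^ 2) →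
      NearDiagonal 20 a x y → NearDiagonal 80 a x y := fun h hd =>
    (exists_or_nearDiagonal_of_nearDiagonal hN h hd).resolve_left hno
  have rot : ∀ {a m n : ℤ},
      N = 15 * a ^ 2 + 4 * ((a + 80 * m) ^ 2 + (a + 80 * m) * (a + 80 * n) + 4 * (a + 80 * n) ^ 2) →
      N = 15 * (a + 80 * n) ^ 2 + 4 * ((a - 40 * m - 20 * n) ^ 2
        + (a - 40 * m - 20 * n) * (a + 40 * m + 20 * n) + 4 * (a + 40 * m + 20 * n) ^ 2) ∧
      NearDiagonal 80 (a + 80 * n) (a - 40 * m - 20 * n) (a + 40 * m + 20 * n) := fun h =>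
    ⟨h.trans (by ring), lift (h.trans (by ring)) ⟨by omega, by omega⟩⟩
  have rot_inv : ∀ {a m n : ℤ},
      N = 15 * a ^ 2 + 4 * ((a + 80 * m) ^ 2 + (a + 80 * m) * (a + 80 * n) + 4 * (a + 80 * n) ^ 2) →
      N = 15 * (a + 40 * m + 40 * n) ^ 2 + 4 * ((a - 20 * m + 140 * n) ^ 2
        + (a - 20 * m + 140 * n) * a + 4 * a ^ 2) ∧
      NearDiagonal 80 (a + 40 * m + 40 * n) (a - 20 * m + 140 * n) a := fun h =>
    ⟨h.trans (by ring), lift (h.trans (by ring)) ⟨by omega, by omega⟩⟩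
  have pow_dvd : ∀ (j : ℕ) {a x y : ℤ}, N = 15 * a ^ 2 + 4 * (x ^ 2 + x * y + 4 * y ^ 2) →
      NearDiagonal 80 a x y → (2 : ℤ) ^ j ∣ y - a := by
    intro j
    induction j with
    | zero => intros; simp
    | succ j ih =>
      rintro a x y h ⟨⟨m, hm⟩, n, hn⟩
      obtain rfl : x = a + 80 * m := by linarith
      obtain rfl : y = a + 80 * n := by linarith
      obtain ⟨r, hr⟩ := ih (rot h).1 (rot h).2
      obtain ⟨s, hs⟩ := ih (rot_inv h).1 (rot_inv h).2
      have hcop : IsCoprime ((2 : ℤ) ^ (j + 1)) 5 := IsCoprime.pow_left (by norm_num)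
      refine hcop.dvd_of_dvd_mul_left ⟨-2 * (r + s), ?_⟩
      rw [pow_succ]
      linear_combination -4 * hr - 4 * hs
  have eq_axis : ∀ {a x y : ℤ}, N = 15 * a ^ 2 + 4 * (x ^ 2 + x * y + 4 * y ^ 2) →
      NearDiagonal 80 a x y → y = a := by
    intro a x y h hd
    by_contra hne
    have hle := Int.le_of_dvd (by positivity [sub_ne_zero.2 hne])
      ((dvd_abs _ _).2 (pow_dvd (y - a).natAbs h hd))
    have hlt : (y - a).natAbs < 2 ^ (y - a).natAbs := Nat.lt_two_pow_self
    rw [Int.abs_eq_natAbs] at hle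
    exact absurd hle (not_le.2 (by exact_mod_cast hlt))
  have hd := lift h hd
  have hya := eq_axis h hd
  obtain ⟨⟨m, hm⟩, n, hn⟩ := hd
  obtain rfl : x = a + 80 * m := by linarith
  obtain rfl : y = a + 80 * n := by linarith
  have hrot := eq_axis (rot h).1 (rot h).2
  obtain rfl : n = 0 := by linarith
  obtain rfl : m = 0 := by linarith
  ring_nf at h
  omega

theorem exists_eq_fifteen_mul_add_sixteen_mul {N a x y : ℤ} (hN : N % 120 = 31)
    (h : N = 15 * a ^ 2 + 4 * (x ^ 2 + x * y + 4 * y ^ 2)) :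
    ∃ a' x' y' : ℤ, N = 15 * a' ^ 2 + 16 * (x' ^ 2 + x' * y' + 4 * y' ^ 2) := by
  rcases exists_or_nearDiagonal hN h with h' | h' | h' | h' | h'
  · exact h'
  · exact exists_of_nearDiagonal hN h h'
  · exact exists_of_nearDiagonal hN (h.trans (by ring)) h'
  · exact exists_of_nearDiagonal hN (h.trans (by ring)) h'
  · exact exists_of_nearDiagonal hN (h.trans (by ring)) h'

theorem exists_odd_eq_sq_add_mul_add (x y : ℤ) (hk : x ^ 2 + x * y + 4 * y ^ 2 ≠ 0) :
    ∃ x' y' : ℤ, x' % 2 = 1 ∧ x ^ 2 + x * y + 4 * y ^ 2 = x' ^ 2 + x' * y' + 4 * y' ^ 2 := by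
  induction hm : x.natAbs + y.natAbs using Nat.strong_induction_on generalizing x y with
  | _ m ih =>
    rcases Int.emod_two_eq_zero_or_one x with hx | hx
    · rcases Int.emod_two_eq_zero_or_one y with hy | hy
      · obtain ⟨s, rfl⟩ : ∃ s, x = 2 * s := ⟨x / 2, by omega⟩
        obtain ⟨t, rfl⟩ : ∃ t, y = 2 * t := ⟨y / 2, by omega⟩
        have hst : s ≠ 0 ∨ t ≠ 0 := by
          by_contra! h
          simp [h.1, h.2] at hk
        obtain ⟨v, w, hv, hvw⟩ := ih (s.natAbs + t.natAbs) (by omega) s t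
          (fun h => hk (by linear_combination 4 * h)) rfl
        exact ⟨v + 4 * w, -v, by omega, by linear_combination 4 * hvw⟩
      · exact ⟨x + y, -y, by omega, by ring⟩
    · exact ⟨x, y, hx, rfl⟩

theorem exists_odd_eq_diagonal {N a x y : ℤ} (hN : N % 120 = 31)
    (h : N = 15 * a ^ 2 + 16 * (x ^ 2 + x * y + 4 * y ^ 2)) :
    ∃ a b c : ℤ, a % 2 = 1 ∧ b % 2 = 1 ∧ c % 2 = 1 ∧
      N = 15 * a ^ 2 + 10 * b ^ 2 + 6 * c ^ 2 := by
  have hk : x ^ 2 + x * y + 4 * y ^ 2 ≠ 0 := by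
    intro hk
    rw [hk] at h
    omega
  have ha : a % 2 = 1 := by
    by_contra hne
    obtain ⟨b, rfl⟩ : ∃ b, a = 2 * b := ⟨a / 2, by omega⟩
    ring_nf at h
    omega
  obtain ⟨v, w, hv, hvw⟩ := exists_odd_eq_sq_add_mul_add x y hk
  exact ⟨a, v + 2 * w, v - 2 * w, ha, by omega, by omega, by linear_combination h + 16 * hvw⟩

/-- For every non negative integer `n`, the equation
`15(4x+1)² + 10(6y+1)² + 6(10z+1)² = 120n + 31` has an integer solution `x, y, z`. -/
theorem rep_120n_31 (n : ℤ) (hn : 0 ≤ n) :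
    ∃ x y z : ℤ,
      15 * (4 * x + 1) ^ 2 + 10 * (6 * y + 1) ^ 2 + 6 * (10 * z + 1) ^ 2
        = 120 * n + 31 := by
  lift n to ℕ using hn
  obtain ⟨a, b, c, d, ha, hd, hd3, habc, hN⟩ := exists_sq_add_eq_mul n
  obtain ⟨u, y, z, h₁⟩ := exists_eq_sq_add_three_mul ha hd hd3 habc hN
  obtain ⟨z, x, w, h₂⟩ := exists_eq_three_mul_add_four_mul (by omega) h₁
  obtain ⟨a, x, y, h₃⟩ := exists_eq_fifteen_mul_add_four_mul (by omega) h₂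
  obtain ⟨a, x, y, h₄⟩ := exists_eq_fifteen_mul_add_sixteen_mul (by omega) h₃
  obtain ⟨a, b, c, ha, hb, hc, h⟩ := exists_odd_eq_diagonal (by omega) h₄
  have hb3 : b % 3 ≠ 0 := by
    intro hb3
    obtain ⟨k, rfl⟩ : ∃ k, b = 3 * k := ⟨b / 3, by omega⟩
    ring_nf at h
    omega
  have hc5 : c % 5 = 1 ∨ c % 5 = 4 := by
    have hsq : c ^ 2 % 5 = 1 := by omega
    have hlt : c % 5 = 0 ∨ c % 5 = 1 ∨ c % 5 = 2 ∨ c % 5 = 3 ∨ c % 5 = 4 := by omega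
    rw [pow_two, Int.mul_emod] at hsq
    rcases hlt with hr | hr | hr | hr | hr <;> simp [hr] at hsq ⊢
  obtain ⟨x, hx⟩ : ∃ x, a = 4 * x + 1 ∨ a = -(4 * x + 1) := by
    rcases (by omega : a % 4 = 1 ∨ a % 4 = 3) with hr | hr
    · exact ⟨a / 4, by omega⟩
    · exact ⟨-a / 4, by omega⟩
  obtain ⟨y, hy⟩ : ∃ y, b = 6 * y + 1 ∨ b = -(6 * y + 1) := by
    rcases (by omega : b % 6 = 1 ∨ b % 6 = 5) with hr | hr
    · exact ⟨b / 6, by omega⟩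
    · exact ⟨-b / 6, by omega⟩
  obtain ⟨z, hz⟩ : ∃ z, c = 10 * z + 1 ∨ c = -(10 * z + 1) := by
    rcases (by omega : c % 10 = 1 ∨ c % 10 = 9) with hr | hr
    · exact ⟨c / 10, by omega⟩
    · exact ⟨-c / 10, by omega⟩
  refine ⟨x, y, z, ?_⟩
  rw [h, sq_eq_sq_iff_eq_or_eq_neg.2 hx, sq_eq_sq_iff_eq_or_eq_neg.2 hy,
    sq_eq_sq_iff_eq_or_eq_neg.2 hz]
end

section
/- For every positive integer n, there exist integers x, y, z with x ≡ y ≡ z (mod 4) such that x² + 3y² + 3z² = 24n + 7; equivalently, 24n + 7 is represented by the ternary quadratic form f(x,y,z) = x² + 3(x−4y)² + 3(x−4z)². -/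
/-- The integral ternary quadratic form `a x² + b xy + c y² + d xz + e yz + f z²`. -/
structure TernaryForm where
  (a b c d e f : ℤ)

namespace TernaryForm

/-- The value of a ternary form at an integer point. -/
def eval (F : TernaryForm) (x y z : ℤ) : ℤ :=
  F.a * x ^ 2 + F.b * (x * y) + F.c * y ^ 2 + F.d * (x * z) + F.e * (y * z) + F.f * z ^ 2

/-- The half-discriminant: half the determinant of the Hessian matrix. -/
def halfDisc (F : TernaryForm) : ℤ :=
  4 * F.a * F.c * F.f + F.b * F.d * F.e - F.a * F.e ^ 2 - F.c * F.d ^ 2 - F.f * F.b ^ 2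

/-- The determinant of the Hessian matrix of the binary form in the first two variables. -/
def binaryDet (F : TernaryForm) : ℤ :=
  4 * F.a * F.c - F.b ^ 2

/-- Positive definite ternary forms of half-discriminant 3 representing `m`. -/
structure PosDiscThreeRep (m : ℤ) (F : TernaryForm) : Prop where
  a_pos : 0 < F.a
  binaryDet_pos : 0 < F.binaryDet
  halfDisc_eq : F.halfDisc = 3
  rep : ∃ x y z, F.eval x y z = m

/-- The substitution `x ↦ x + k y + l z`. -/
def shearFirst (F : TernaryForm) (k l : ℤ) : TernaryForm where
  a := F.a
  b := F.b + 2 * F.a * k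
  c := F.c + F.b * k + F.a * k ^ 2
  d := F.d + 2 * F.a * l
  e := F.e + F.b * l + F.d * k + 2 * F.a * k * l
  f := F.f + F.d * l + F.a * l ^ 2

/-- The substitution `y ↦ y + k z`. -/
def shearSecond (F : TernaryForm) (k : ℤ) : TernaryForm where
  a := F.a
  b := F.b
  c := F.c
  d := F.d + F.b * k
  e := F.e + 2 * F.c * k
  f := F.f + F.e * k + F.c * k ^ 2

/-- Interchange of the first two variables. -/
def swapFirst (F : TernaryForm) : TernaryForm := ⟨F.c, F.b, F.a, F.e, F.d, F.f⟩

/-- Interchange of the last two variables. -/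
def swapLast (F : TernaryForm) : TernaryForm := ⟨F.a, F.d, F.f, F.b, F.e, F.c⟩

variable {m : ℤ} {F : TernaryForm}

lemma PosDiscThreeRep.shearFirst (h : F.PosDiscThreeRep m) (k l : ℤ) :
    (F.shearFirst k l).PosDiscThreeRep m := by
  obtain ⟨ha, hA, hH, x, y, z, hr⟩ := h
  refine ⟨ha, hA.trans_eq ?_, hH ▸ ?_, x - k * y - l * z, y, z, hr ▸ ?_⟩ <;>
    simp only [TernaryForm.shearFirst, binaryDet, halfDisc, eval] <;> ring

lemma PosDiscThreeRep.shearSecond (h : F.PosDiscThreeRep m) (k : ℤ) :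
    (F.shearSecond k).PosDiscThreeRep m := by
  obtain ⟨ha, hA, hH, x, y, z, hr⟩ := h
  refine ⟨ha, hA, hH ▸ ?_, x, y - k * z, z, hr ▸ ?_⟩ <;>
    simp only [TernaryForm.shearSecond, halfDisc, eval] <;> ring

lemma PosDiscThreeRep.swapFirst (h : F.PosDiscThreeRep m) :
    F.swapFirst.PosDiscThreeRep m := by
  obtain ⟨ha, hA, hH, x, y, z, hr⟩ := h
  refine ⟨?_, hA.trans_eq ?_, hH ▸ ?_, y, x, z, hr ▸ ?_⟩
  · simp only [binaryDet, TernaryForm.swapFirst] at *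
    nlinarith [sq_nonneg F.b]
  all_goals simp only [TernaryForm.swapFirst, binaryDet, halfDisc, eval]; ring

lemma four_mul_binaryDet_mul_sub_sq (F : TernaryForm) :
    4 * F.binaryDet * F.swapLast.binaryDet - (4 * F.a * F.e - 2 * F.b * F.d) ^ 2 =
      16 * F.a * F.halfDisc := by
  simp only [swapLast, binaryDet, halfDisc]
  ring

lemma PosDiscThreeRep.swapLast (h : F.PosDiscThreeRep m) :
    F.swapLast.PosDiscThreeRep m := by
  have key := F.four_mul_binaryDet_mul_sub_sq
  obtain ⟨ha, hA, hH, x, y, z, hr⟩ := h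
  refine ⟨ha, ?_, hH ▸ ?_, x, z, y, hr ▸ ?_⟩
  · rw [hH] at key
    have : 0 < F.binaryDet * F.swapLast.binaryDet := by
      nlinarith [sq_nonneg (4 * F.a * F.e - 2 * F.b * F.d)]
    exact (pos_iff_pos_of_mul_pos this).1 hA
  all_goals simp only [TernaryForm.swapLast, halfDisc, eval]; ring

lemma PosDiscThreeRep.exists_minimal (h : F.PosDiscThreeRep m) :
    ∃ G : TernaryForm, G.PosDiscThreeRep m ∧ ∀ H : TernaryForm, H.PosDiscThreeRep m →
      G.a ≤ H.a ∧ (G.a = H.a → G.binaryDet ≤ H.binaryDet) := by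
  obtain ⟨G, hG, hmin⟩ := WellFounded.has_min
    (InvImage.wf (fun G : TernaryForm => (G.a.toNat, G.binaryDet.toNat))
      (WellFounded.prod_lex Nat.lt_wfRel.wf Nat.lt_wfRel.wf))
    {G | G.PosDiscThreeRep m} ⟨F, h⟩
  refine ⟨G, hG, fun H hH => ?_⟩
  have hlex := hmin H hH
  simp only [InvImage, Prod.lex_def, not_or, not_and] at hlex
  obtain ⟨h₁, h₂⟩ := hlex
  have h₁ : ¬ H.a.toNat < G.a.toNat := h₁
  have h₂ : H.a.toNat = G.a.toNat → ¬ H.binaryDet.toNat < G.binaryDet.toNat := h₂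
  have := hG.a_pos
  have := hG.binaryDet_pos
  have := hH.a_pos
  have := hH.binaryDet_pos
  constructor
  · omega
  · intro h
    have := h₂ (by rw [h])
    omega

lemma exists_abs_add_two_mul_le (b : ℤ) {a : ℤ} (ha : 0 < a) : ∃ k : ℤ, |b + 2 * a * k| ≤ a := by
  refine ⟨-((b + a) / (2 * a)), ?_⟩
  have h₁ := Int.emod_nonneg (b + a) (by omega : 2 * a ≠ 0)
  have h₂ := Int.emod_lt_of_pos (b + a) (by omega : 0 < 2 * a)
  have h₃ := Int.emod_add_mul_ediv (b + a) (2 * a)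
  rw [abs_le]
  constructor <;> linarith

/-- A minimal form can be chosen with small off-diagonal coefficients. -/
lemma PosDiscThreeRep.exists_reduced (h : F.PosDiscThreeRep m) :
    ∃ G : TernaryForm, G.PosDiscThreeRep m ∧ |G.b| ≤ G.a ∧ |G.d| ≤ G.a ∧
      |4 * G.a * G.e - 2 * G.b * G.d| ≤ G.binaryDet ∧ G.a ≤ G.c ∧
      G.binaryDet ≤ G.swapLast.binaryDet := by
  obtain ⟨G, hG, hmin⟩ := h.exists_minimal
  obtain ⟨k, hk⟩ := exists_abs_add_two_mul_le (4 * G.a * G.e - 2 * G.b * G.d) hG.binaryDet_pos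
  obtain ⟨l, hl⟩ := exists_abs_add_two_mul_le (G.shearSecond k).b hG.a_pos
  obtain ⟨n, hn⟩ := exists_abs_add_two_mul_le (G.shearSecond k).d hG.a_pos
  have hG' := (hG.shearSecond k).shearFirst l n
  have hA : ((G.shearSecond k).shearFirst l n).binaryDet = G.binaryDet := by
    simp only [TernaryForm.shearFirst, TernaryForm.shearSecond, binaryDet]
    ring
  refine ⟨_, hG', hl, hn, ?_, (hmin _ hG'.swapFirst).1, ?_⟩
  · rw [hA]
    convert hk using 2
    simp only [TernaryForm.shearFirst, TernaryForm.shearSecond, binaryDet]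
    ring
  · rw [hA]
    exact (hmin _ hG'.swapLast).2 rfl

/-- Up to equivalence, `x² + y² + yz + z²` is the only positive definite integer-valued ternary
form of half-discriminant 3. -/
theorem PosDiscThreeRep.exists_eq (h : F.PosDiscThreeRep m) :
    ∃ x y z : ℤ, x ^ 2 + (y ^ 2 + y * z + z ^ 2) = m := by
  obtain ⟨⟨a, b, c, d, e, f⟩, ⟨ha, hA, hH, x, y, z, hr⟩, hb, hd, hB, hac, hAC⟩ := h.exists_reduced
  have key := (TernaryForm.mk a b c d e f).four_mul_binaryDet_mul_sub_sq
  rw [hH] at key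
  simp only [TernaryForm.swapLast, binaryDet, eval] at *
  clear hH
  obtain ⟨B, hBdef⟩ : ∃ B, B = 4 * a * e - 2 * b * d := ⟨_, rfl⟩
  obtain ⟨A, hAdef⟩ : ∃ A, A = 4 * a * c - b ^ 2 := ⟨_, rfl⟩
  obtain ⟨C, hCdef⟩ : ∃ C, C = 4 * a * f - d ^ 2 := ⟨_, rfl⟩
  rw [← hBdef, ← hAdef] at hB
  rw [← hBdef, ← hAdef, ← hCdef] at key
  rw [← hAdef, ← hCdef] at hAC
  rw [← hAdef] at hA
  have hB2 : B ^ 2 ≤ A ^ 2 := sq_le_sq' (abs_le.1 hB).1 (abs_le.1 hB).2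
  have hb2 : b ^ 2 ≤ a ^ 2 := sq_le_sq' (abs_le.1 hb).1 (abs_le.1 hb).2
  have hA2 : A ^ 2 ≤ 16 * a := by nlinarith
  have h3a : 3 * a ^ 2 ≤ A := by nlinarith
  have ha1 : a = 1 := by
    by_contra hne
    have h2 : 2 ≤ a := by omega
    have h12 : 12 ≤ A := by nlinarith
    nlinarith
  subst ha1
  have hA4 : A ≤ 4 := by nlinarith
  rw [abs_le] at hb hd hB
  obtain ⟨hb₁, hb₂⟩ := hb
  obtain ⟨hd₁, hd₂⟩ := hd
  obtain ⟨hB₁, hB₂⟩ := hB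
  have hb' : b = -1 ∨ b = 0 ∨ b = 1 := by omega
  have hd' : d = -1 ∨ d = 0 ∨ d = 1 := by omega
  have hc : c = 1 := by rcases hb' with rfl | rfl | rfl <;> omega
  subst hc
  have he : e = -1 ∨ e = 0 ∨ e = 1 := by
    rcases hb' with rfl | rfl | rfl <;> rcases hd' with rfl | rfl | rfl <;> omega
  rcases hb' with rfl | rfl | rfl <;> rcases hd' with rfl | rfl | rfl <;>
    rcases he with rfl | rfl | rfl <;> norm_num at hAdef hBdef hCdef <;> subst hAdef hBdef <;>
    first
    | omega
    | (obtain rfl : f = 1 := by omega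
       first
       | exact ⟨x, y, z, by linear_combination hr⟩
       | exact ⟨x, y, -z, by linear_combination hr⟩
       | exact ⟨y, x, z, by linear_combination hr⟩
       | exact ⟨y, x, -z, by linear_combination hr⟩
       | exact ⟨z, x, y, by linear_combination hr⟩
       | exact ⟨z, x, -y, by linear_combination hr⟩)

end TernaryForm

open NumberTheorySymbols in
/-- Quadratic reciprocity for the residue needed to write down a suitable ternary form. -/
lemma isSquare_neg_of_four_mul_mul_eq {N p k : ℕ} [Fact p.Prime] (hN : N % 12 = 7)
    (h : 4 * k * N = 3 * p + 1) : IsSquare ((-k : ℤ) : ZMod p) := by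
  have hp4 : p % 4 = 1 := by
    have : 4 * k * N = 4 * (k * N) := by ring
    omega
  have hpodd : Odd p := Nat.odd_iff.2 (by omega)
  have hNodd : Odd N := Nat.odd_iff.2 (by omega)
  have h3p : J(3 * p | N) = -1 := by
    have : J(3 * p | N) = J(-1 | N) := by
      apply jacobiSym.mod_left'
      refine Int.ModEq.symm ?_
      rw [Int.modEq_iff_dvd]
      exact ⟨4 * k, by push_cast [← Nat.cast_inj (R := ℤ)] at h; linarith⟩
    rw [this, jacobiSym.at_neg_one hNodd, ZMod.χ₄_nat_three_mod_four (by omega)]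
  have h3 : J(3 | N) = -1 := by
    have := jacobiSym.quadratic_reciprocity_three_mod_four (a := 3) (b := N) rfl (by omega)
    push_cast at this
    rw [this, jacobiSym.mod_left, show (N : ℤ) % (3 : ℕ) = 1 by omega, jacobiSym.one_left]
  have hpN : J(N | p) = 1 := by
    rw [jacobiSym.quadratic_reciprocity_one_mod_four' hNodd hp4]
    rw [jacobiSym.mul_left, h3] at h3p
    linarith
  have hk : J(k | p) = 1 := by
    have h₁ : J(4 * k * N | p) = J(1 | p) := by
      apply jacobiSym.mod_left'
      refine Int.ModEq.symm ?_
      rw [Int.modEq_iff_dvd]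
      exact ⟨3, by push_cast [← Nat.cast_inj (R := ℤ)] at h; linarith⟩
    rw [jacobiSym.mul_left, jacobiSym.mul_left, jacobiSym.at_four hpodd, hpN,
      jacobiSym.one_left] at h₁
    linarith
  apply ZMod.isSquare_of_jacobiSym_eq_one
  rw [jacobiSym.neg _ hpodd, hk, ZMod.χ₄_nat_one_mod_four hp4, one_mul]

/-- Every `N ≡ 7 (mod 12)` satisfies `3 N = x² + y² + yz + z²`. -/
theorem exists_three_mul_eq_sq_add {N : ℕ} (hN : N % 12 = 7) :
    ∃ x y z : ℤ, x ^ 2 + (y ^ 2 + y * z + z ^ 2) = 3 * N := by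
  obtain ⟨p, hpN, hp, hmod⟩ := Nat.forall_exists_prime_gt_and_modEq (4 * N)
    (q := 4 * N) (a := (4 * N - 1) / 3) (by omega) (by
      have h : 4 * N = 3 * ((4 * N - 1) / 3) + 1 := by omega
      generalize (4 * N - 1) / 3 = a at h ⊢
      rw [h]
      simp)
  have : Fact p.Prime := ⟨hp⟩
  obtain ⟨k, hk⟩ : ∃ k : ℕ, 4 * k * N = 3 * p + 1 := by
    have hlt : (4 * N - 1) / 3 < 4 * N := by omega
    have h₁ : p % (4 * N) = (4 * N - 1) / 3 := by
      rw [hmod, Nat.mod_eq_of_lt hlt]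
    have h₂ := Nat.mod_add_div p (4 * N)
    have h₃ : 4 * N = 3 * ((4 * N - 1) / 3) + 1 := by omega
    refine ⟨3 * (p / (4 * N)) + 1, ?_⟩
    rw [h₁] at h₂
    linarith
  obtain ⟨r, hr⟩ := isSquare_neg_of_four_mul_mul_eq hN hk
  obtain ⟨b, rfl⟩ := ZMod.intCast_surjective r
  rw [← Int.cast_mul, ZMod.intCast_eq_intCast_iff, Int.modEq_iff_dvd] at hr
  obtain ⟨c, hc⟩ := hr
  have hk' : (4 * k * N : ℤ) = 3 * p + 1 := by exact_mod_cast hk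
  have hp0 : (0 : ℤ) < p := by exact_mod_cast hp.pos
  have hk0 : (0 : ℤ) < k := by
    rcases Nat.eq_zero_or_pos k with rfl | h
    · simp at hk
    · exact_mod_cast h
  refine TernaryForm.PosDiscThreeRep.exists_eq (F := ⟨p, 2 * b, c, 0, 3, 3 * N⟩)
    ⟨hp0, ?_, ?_, 0, 0, 1, ?_⟩
  · simp only [TernaryForm.binaryDet]
    linarith
  · simp only [TernaryForm.halfDisc]
    linear_combination (-12 * N : ℤ) * hc + 3 * hk'
  · simp [TernaryForm.eval]

/-- Every value of `y² + yz + z²` is a value of `v² + 3w²`. -/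
lemma exists_sq_add_three_mul_sq_eq (y z : ℤ) :
    ∃ v w : ℤ, v ^ 2 + 3 * w ^ 2 = y ^ 2 + y * z + z ^ 2 := by
  rcases Int.even_or_odd' y with ⟨s, rfl | rfl⟩
  · exact ⟨z + s, s, by ring⟩
  rcases Int.even_or_odd' z with ⟨t, rfl | rfl⟩
  · exact ⟨2 * s + 1 + t, t, by ring⟩
  · exact ⟨s - t, s + t + 1, by ring⟩

lemma three_dvd_of_three_dvd_sq_add_sq {u v : ℤ} (h : 3 ∣ u ^ 2 + v ^ 2) : 3 ∣ u ∧ 3 ∣ v := by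
  have hu : u % 3 = 0 ∨ u % 3 = 1 ∨ u % 3 = 2 := by omega
  have hv : v % 3 = 0 ∨ v % 3 = 1 ∨ v % 3 = 2 := by omega
  have h' := Int.emod_eq_zero_of_dvd h
  rcases hu with hu | hu | hu <;> rcases hv with hv | hv | hv <;>
    simp [pow_two, Int.add_emod, Int.mul_emod, hu, hv] at h'
  all_goals omega

/-- Every `N ≡ 7 (mod 12)` is represented by `x² + 3y² + 3z²`. -/
theorem exists_sq_add_three_mul_sq_add_three_mul_sq_s10 {N : ℕ} (hN : N % 12 = 7) :
    ∃ x y z : ℤ, x ^ 2 + 3 * y ^ 2 + 3 * z ^ 2 = N := by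
  obtain ⟨u, s, t, h⟩ := exists_three_mul_eq_sq_add hN
  obtain ⟨v, w, hvw⟩ := exists_sq_add_three_mul_sq_eq s t
  obtain ⟨⟨y, rfl⟩, ⟨z, rfl⟩⟩ := three_dvd_of_three_dvd_sq_add_sq (u := u) (v := v)
    ⟨N - w ^ 2, by linarith⟩
  exact ⟨w, y, z, by linarith⟩

lemma Int.sq_emod_eight (x : ℤ) :
    x % 2 = 1 ∧ x ^ 2 % 8 = 1 ∨ x % 4 = 0 ∧ x ^ 2 % 8 = 0 ∨ x % 4 = 2 ∧ x ^ 2 % 8 = 4 := by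
  have : x % 8 = 0 ∨ x % 8 = 1 ∨ x % 8 = 2 ∨ x % 8 = 3 ∨ x % 8 = 4 ∨ x % 8 = 5 ∨ x % 8 = 6 ∨
    x % 8 = 7 := by omega
  rcases this with h | h | h | h | h | h | h | h <;>
    (simp [pow_two, Int.mul_emod, h]; omega)

/-- If `x² + 3y² + 3z² ≡ 7 (mod 8)` with `x` and `z` even, then the value is also attained at a
point with odd coordinates. -/
lemma exists_odd_of_even_of_even {x y z m : ℤ} (hm : m % 8 = 7) (hx : Even x) (hz : Even z)
    (h : x ^ 2 + 3 * y ^ 2 + 3 * z ^ 2 = m) :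
    ∃ x' y' z' : ℤ, Odd x' ∧ Odd y' ∧ Odd z' ∧ x' ^ 2 + 3 * y' ^ 2 + 3 * z' ^ 2 = m := by
  obtain ⟨s, rfl⟩ := hx
  obtain ⟨t, rfl⟩ := hz
  have h₁ := Int.sq_emod_eight (s + s)
  have h₂ := Int.sq_emod_eight (t + t)
  have h₃ := Int.sq_emod_eight y
  refine ⟨s + 3 * t, y, s - t, ?_, ?_, ?_, by rw [← h]; ring⟩ <;> rw [Int.odd_iff] <;> omega

/-- Every `N ≡ 7 (mod 24)` is the value of `x² + 3y² + 3z²` at a point with odd coordinates. -/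
theorem exists_odd_sq_add_three_mul_sq_add_three_mul_sq {N : ℕ} (hN : N % 24 = 7) :
    ∃ x y z : ℤ, Odd x ∧ Odd y ∧ Odd z ∧ x ^ 2 + 3 * y ^ 2 + 3 * z ^ 2 = N := by
  obtain ⟨x, y, z, h⟩ := exists_sq_add_three_mul_sq_add_three_mul_sq_s10 (N := N) (by omega)
  have hm : (N : ℤ) % 8 = 7 := by omega
  by_cases hx : Even x
  · by_cases hz : Even z
    · exact exists_odd_of_even_of_even hm hx hz h
    · refine exists_odd_of_even_of_even hm hx (y := z) (z := y) ?_ (by linarith)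
      rw [Int.even_iff] at *
      have := Int.sq_emod_eight x
      have := Int.sq_emod_eight y
      have := Int.sq_emod_eight z
      omega
  · refine ⟨x, y, z, ?_, ?_, ?_, h⟩ <;> rw [Int.even_iff] at hx <;> rw [Int.odd_iff] <;>
      have := Int.sq_emod_eight x <;> have := Int.sq_emod_eight y <;>
      have := Int.sq_emod_eight z <;> omega

lemma Odd.exists_modEq_one_sq_eq {x : ℤ} (hx : Odd x) :
    ∃ y : ℤ, y ≡ 1 [ZMOD 4] ∧ y ^ 2 = x ^ 2 := by
  rcases Int.emod_two_eq_zero_or_one x with h | h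
  · rw [Int.odd_iff] at hx
    omega
  · by_cases h4 : x % 4 = 1
    · exact ⟨x, h4, rfl⟩
    · exact ⟨-x, show -x % 4 = 1 by omega, neg_sq x⟩

/-- For every positive integer `n`, there exist integers `x, y, z` with
`x ≡ y ≡ z (mod 4)` such that `x² + 3y² + 3z² = 24n + 7`; equivalently,
`24n + 7` is represented by the form `f(x,y,z) = x² + 3(x−4y)² + 3(x−4z)²`. -/
theorem rep_24n_7_congruent_mod_four (n : ℤ) (hn : 0 < n) :
    (∃ x y z : ℤ, x ≡ y [ZMOD 4] ∧ y ≡ z [ZMOD 4] ∧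
        x ^ 2 + 3 * y ^ 2 + 3 * z ^ 2 = 24 * n + 7) ∧
    (∃ x y z : ℤ,
        x ^ 2 + 3 * (x - 4 * y) ^ 2 + 3 * (x - 4 * z) ^ 2 = 24 * n + 7) := by
  obtain ⟨N, hN⟩ := Int.eq_ofNat_of_zero_le (show 0 ≤ 24 * n + 7 by omega)
  obtain ⟨x₀, y₀, z₀, hx₀, hy₀, hz₀, h⟩ :=
    exists_odd_sq_add_three_mul_sq_add_three_mul_sq (N := N) (by omega)
  obtain ⟨x, hx, hxx⟩ := hx₀.exists_modEq_one_sq_eq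
  obtain ⟨y, hy, hyy⟩ := hy₀.exists_modEq_one_sq_eq
  obtain ⟨z, hz, hzz⟩ := hz₀.exists_modEq_one_sq_eq
  rw [← hxx, ← hyy, ← hzz, ← hN] at h
  refine ⟨⟨x, y, z, hx.trans hy.symm, hy.trans hz.symm, h⟩, ?_⟩
  obtain ⟨s, hs⟩ := (hy.trans hx.symm).dvd
  obtain ⟨t, ht⟩ := (hz.trans hx.symm).dvd
  refine ⟨x, s, t, ?_⟩
  rw [← hs, ← ht, sub_sub_cancel, sub_sub_cancel]
  exact h
end

section
/- Every integer m with m ≡ 31 (mod 40) that is represented by the ternary quadratic form 10x² + 15y² + 24z² is also represented by the ternary quadratic form x² + 30y² + 120z². -/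
/-- The integers represented by `x² + 30y² + 120z²`. -/
def IsTargetValue (m : ℤ) : Prop := ∃ x y z : ℤ, x ^ 2 + 30 * y ^ 2 + 120 * z ^ 2 = m

/-- An isometry with denominator `8`, applied to a vector with even first coordinate. -/
lemma isTargetValue_of_four_dvd {a y z : ℤ} (h : 4 ∣ a - y - z) :
    IsTargetValue (10 * (2 * a) ^ 2 + 15 * y ^ 2 + 24 * z ^ 2) := by
  obtain ⟨k, hk⟩ := h
  obtain rfl : a = 4 * k + y + z := by linarith
  exact ⟨5 * (4 * k + y + z) + 3 * z, 2 * k + y, k, by ring⟩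

/-- An isometry with denominator `5`. -/
lemma isTargetValue_of_five_dvd {x y z : ℤ} (h : 5 ∣ x + y - z) :
    IsTargetValue (10 * x ^ 2 + 15 * y ^ 2 + 24 * z ^ 2) := by
  obtain ⟨k, hk⟩ := h
  obtain rfl : z = x + y - 5 * k := by linarith
  exact ⟨2 * x - 3 * y, x + y - 4 * k, k, by ring⟩

/-- An integer `u² + 3/10 (p² + q²)` is represented by `x² + 30y² + 120z²` when `p` and `q` are
suitably divisible. -/
lemma isTargetValue_of_ten_mul {m u p q : ℤ} (hm : 10 * u ^ 2 + 3 * (p ^ 2 + q ^ 2) = 10 * m)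
    (hp : 10 ∣ p) (hq : 20 ∣ q) : IsTargetValue m := by
  obtain ⟨v, rfl⟩ := hp
  obtain ⟨w, rfl⟩ := hq
  exact ⟨u, v, w, by linarith⟩

/-- Isometries with denominator `40`, for vectors with `x + y ≡ 0 (mod 5)`, where `x = 2a`. -/
lemma isTargetValue_of_five_dvd_add {a y z : ℤ} (hy : y % 2 = 1) (haz : 2 ∣ a + z)
    (h : 5 ∣ 2 * a + y) : IsTargetValue (10 * (2 * a) ^ 2 + 15 * y ^ 2 + 24 * z ^ 2) := by
  by_cases h4 : 4 ∣ a - z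
  · exact isTargetValue_of_ten_mul (u := a + 3 * y + 3 * z) (p := 9 * a + 2 * y - 5 * z)
      (q := 7 * a - 4 * y + 5 * z) (by ring) (by omega) (by omega)
  · exact isTargetValue_of_ten_mul (u := a + 3 * y + 3 * z) (p := 7 * a - 4 * y + 5 * z)
      (q := 9 * a + 2 * y - 5 * z) (by ring) (by omega) (by omega)

/-- Isometries with denominator `40`, for vectors with `x + y ≡ -2z (mod 5)`, where `x = 2a`. -/
lemma isTargetValue_of_five_dvd_add_two_mul {a y z : ℤ} (hy : y % 2 = 1) (haz : 2 ∣ a + z)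
    (h : 5 ∣ 2 * a + y + 2 * z) :
    IsTargetValue (10 * (2 * a) ^ 2 + 15 * y ^ 2 + 24 * z ^ 2) := by
  by_cases h4 : 4 ∣ a - z
  · exact isTargetValue_of_ten_mul (u := a + 3 * y + 3 * z) (p := 11 * a - 2 * y + z)
      (q := 3 * a + 4 * y - 7 * z) (by ring) (by omega) (by omega)
  · exact isTargetValue_of_ten_mul (u := a + 3 * y + 3 * z) (p := 3 * a + 4 * y - 7 * z)
      (q := 11 * a - 2 * y + z) (by ring) (by omega) (by omega)

lemma even_and_odd_of_modEq {x y z : ℤ}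
    (h : 10 * x ^ 2 + 15 * y ^ 2 + 24 * z ^ 2 ≡ 31 [ZMOD 40]) : x % 2 = 0 ∧ y % 2 = 1 := by
  unfold Int.ModEq at h
  have hy : y % 2 = 1 := by
    by_contra hy
    have : 2 ∣ y ^ 2 := dvd_pow (by omega) two_ne_zero
    omega
  have hy4 := Int.sq_mod_four_eq_one_of_odd (Int.odd_iff.mpr hy)
  refine ⟨?_, hy⟩
  by_contra hx
  have hx4 := Int.sq_mod_four_eq_one_of_odd (Int.odd_iff.mpr (by omega : x % 2 = 1))
  omega

lemma not_five_dvd_of_modEq {x y z : ℤ}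
    (h : 10 * x ^ 2 + 15 * y ^ 2 + 24 * z ^ 2 ≡ 31 [ZMOD 40]) : ¬ 5 ∣ z := by
  intro hz
  have hz2 : 5 ∣ z ^ 2 := dvd_pow hz two_ne_zero
  unfold Int.ModEq at h
  omega

lemma five_dvd_cases {w z : ℤ} (hz : ¬ 5 ∣ z) :
    5 ∣ w ∨ 5 ∣ w - z ∨ 5 ∣ w - -z ∨ 5 ∣ w + 2 * z ∨ 5 ∣ w + 2 * -z := by
  have hz' : z % 5 = 1 ∨ z % 5 = 2 ∨ z % 5 = 3 ∨ z % 5 = 4 := by omega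
  have hw : w % 5 = 0 ∨ w % 5 = 1 ∨ w % 5 = 2 ∨ w % 5 = 3 ∨ w % 5 = 4 := by omega
  rcases hz' with hz' | hz' | hz' | hz' <;> rcases hw with hw | hw | hw | hw | hw <;> omega

/-- Every integer `m ≡ 31 (mod 40)` represented by `10x² + 15y² + 24z²` is
also represented by `x² + 30y² + 120z²`. -/
theorem rep_transfer_40_31 (m : ℤ) (hm : m ≡ 31 [ZMOD 40])
    (h : ∃ x y z : ℤ, 10 * x ^ 2 + 15 * y ^ 2 + 24 * z ^ 2 = m) :
    ∃ x y z : ℤ, x ^ 2 + 30 * y ^ 2 + 120 * z ^ 2 = m := by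
  obtain ⟨x, y, z, rfl⟩ := h
  change IsTargetValue _
  obtain ⟨hx, hy⟩ := even_and_odd_of_modEq hm
  have hz := not_five_dvd_of_modEq hm
  obtain ⟨a, rfl⟩ : 2 ∣ x := by omega
  by_cases haz : 2 ∣ a + z
  · have hcases := five_dvd_cases (w := 2 * a + y) hz
    rcases hcases with h | h | h | h | h
    · exact isTargetValue_of_five_dvd_add hy haz h
    · exact isTargetValue_of_five_dvd h
    · rw [← neg_sq z]
      exact isTargetValue_of_five_dvd h
    · exact isTargetValue_of_five_dvd_add_two_mul hy haz h
    · rw [← neg_sq z]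
      exact isTargetValue_of_five_dvd_add_two_mul hy (by omega) h
  · have hcases : 4 ∣ a - y - z ∨ 4 ∣ a - -y - z := by omega
    rcases hcases with h | h
    · exact isTargetValue_of_four_dvd h
    · rw [← neg_sq y]
      exact isTargetValue_of_four_dvd h
end
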